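/- Let p be an odd prime, let F be the unramified quadratic extension of the field ℚ_p of p-adic numbers, let G = GL_2(F) with its natural topology as an open subset of the 2×2 matrices over F, and let k be an algebraic closure of the finite field F_p. Then there exists a k-vector space V together with a smooth linear action of G on V (i.e., the stabilizer of every vector is open in G) such that the representation is irreducible (V ≠ 0 and the only G-stable k-subspaces of V are 0 and V) and non-admissible (it is not the case that for every compact open subgroup H of G the subspace V^H of H-fixed vectors is finite-dimensional over k). -/

import Mathlib

open Matrix

theorem exists_irreducible_of_shift {k G N : Type} [Field k] [Group G] [TopologicalSpace G]
    [IsTopologicalGroup G] [AddCommGroup N] [Module k N] (R : Representation k G N)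
    (H : Subgroup G) (hH : IsOpen (H : Set G)) (v : N) (hv : v ≠ 0) (r l : MonoidAlgebra k G)
    (hfix : ∀ n : ℕ, ∀ h ∈ H, R h (R.asAlgebraHom (r ^ n) v) = R.asAlgebraHom (r ^ n) v)
    (hlr : ∀ n : ℕ, R.asAlgebraHom (l * r ^ (n + 1)) v = R.asAlgebraHom (r ^ n) v)
    (hl : R.asAlgebraHom l v = 0) :
    ∃ (V : Type) (_ : AddCommGroup V) (_ : Module k V) (ρ : Representation k G V),
      (∀ v : V, IsOpen {g : G | ρ g v = v}) ∧ Nontrivial V ∧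
      (∀ W : Submodule k V, (∀ g : G, ∀ v ∈ W, ρ g v ∈ W) → W = ⊥ ∨ W = ⊤) ∧
      ¬ FiniteDimensional k (Representation.invariants (ρ.comp H.subtype)) := by
  classical
  let A := MonoidAlgebra k G
  let J : Ideal A :=
    { carrier := {a | R.asAlgebraHom a v = 0}
      add_mem' := fun {a b} ha hb => by
        simp only [Set.mem_ofPred_eq] at *
        rw [map_add, LinearMap.add_apply, ha, hb, add_zero]
      zero_mem' := by simp
      smul_mem' := fun c x hx => by
        simp only [Set.mem_ofPred_eq] at *
        rw [smul_eq_mul, map_mul, Module.End.mul_apply, hx, map_zero] }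
  have memJ : ∀ a b : A, R.asAlgebraHom a v = R.asAlgebraHom b v → a - b ∈ J := fun a b h => by
    change R.asAlgebraHom (a - b) v = 0
    rw [map_sub, LinearMap.sub_apply, h, sub_self]
  have hJ : J ≠ ⊤ := by
    intro h
    have : (1 : A) ∈ J := h ▸ Submodule.mem_top
    change R.asAlgebraHom 1 v = 0 at this
    rw [map_one] at this
    exact hv this
  obtain ⟨m, hm, hJm⟩ := Ideal.exists_le_maximal J hJ
  let V := A ⧸ m
  let ρ : Representation k G V :=
    (Algebra.lsmul k k V : A →ₐ[k] Module.End k V).toMonoidHom.comp (MonoidAlgebra.of k G)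
  have hρ : ∀ (g : G) (x : V), ρ g x = MonoidAlgebra.of k G g • x := fun _ _ => rfl
  have hsimple : IsSimpleModule A V := isSimpleModule_iff_isCoatom.mpr hm.out
  let e : V := Submodule.Quotient.mk (1 : A)
  have he : ∀ a : A, (Submodule.Quotient.mk a : V) = a • e := fun a => by
    rw [← Submodule.Quotient.mk_smul, smul_eq_mul, mul_one]
  have hmk : ∀ a b : A, R.asAlgebraHom a v = R.asAlgebraHom b v → a • e = b • e := fun a b h => by
    rw [← he, ← he]
    exact (Submodule.Quotient.eq m).mpr (hJm (memJ a b h))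
  have he0 : e ≠ 0 := fun h =>
    hm.ne_top ((Ideal.eq_top_iff_one m).mpr ((Submodule.Quotient.mk_eq_zero m).mp h))
  have hsmooth : ∀ x : V, ∃ U ∈ nhds (1 : G), ∀ g ∈ U, ρ g x = x := by
    intro x
    obtain ⟨a, rfl⟩ := Submodule.Quotient.mk_surjective m x
    induction a using MonoidAlgebra.induction_linear with
    | zero => exact ⟨Set.univ, Filter.univ_mem, fun g _ => by
        rw [Submodule.Quotient.mk_zero, map_zero]⟩
    | add a b ha hb =>
      obtain ⟨U, hU, hU'⟩ := ha
      obtain ⟨W, hW, hW'⟩ := hb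
      refine ⟨U ∩ W, Filter.inter_mem hU hW, fun g hg => ?_⟩
      rw [Submodule.Quotient.mk_add, map_add, hU' g hg.1, hW' g hg.2]
    | single g c =>
      refine ⟨(fun x => g⁻¹ * x * g) ⁻¹' H, ?_, fun x hx => ?_⟩
      · refine (by fun_prop : Continuous fun x : G => g⁻¹ * x * g).continuousAt.preimage_mem_nhds ?_
        exact hH.mem_nhds (by simp [H.one_mem])
      · rw [he, hρ, smul_smul]
        refine hmk _ _ ?_
        have h := hfix 0 _ hx
        simp only [pow_zero, map_one, Module.End.one_apply] at h
        have h2 : R x (R g v) = R g v := by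
          have := congrArg (R g) h
          rw [← Module.End.mul_apply, ← map_mul] at this
          rw [← Module.End.mul_apply, ← map_mul]
          convert this using 3
          group
        rw [map_mul, Module.End.mul_apply, MonoidAlgebra.of_apply,
          Representation.asAlgebraHom_single, Representation.asAlgebraHom_single,
          one_smul, LinearMap.smul_apply, map_smul, h2]
  refine ⟨V, inferInstance, inferInstance, ρ, ?_, ⟨e, 0, he0⟩, ?_, ?_⟩
  · intro x
    let S : Subgroup G :=
      { carrier := {g | ρ g x = x}
        mul_mem' := fun {a b} ha hb => by
          simp only [Set.mem_ofPred_eq] at *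
          rw [map_mul, Module.End.mul_apply, hb, ha]
        one_mem' := by simp
        inv_mem' := fun {a} ha => by
          simp only [Set.mem_ofPred_eq] at *
          nth_rewrite 1 [← ha]
          rw [← Module.End.mul_apply, ← map_mul]
          simp }
    obtain ⟨U, hU, hU'⟩ := hsmooth x
    exact S.isOpen_of_mem_nhds (g := 1) (Filter.mem_of_superset hU hU')
  · intro W hW
    let W' : Submodule A V :=
      { W with
        smul_mem' := fun a x hx => by
          induction a using MonoidAlgebra.induction_linear with
          | zero => simp
          | add a b ha hb => rw [add_smul]; exact W.add_mem ha hb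
          | single g c =>
            have : (MonoidAlgebra.single g c : A) = c • MonoidAlgebra.of k G g := by simp
            rw [this, smul_assoc]
            exact W.smul_mem c (hW g x hx) }
    rcases eq_bot_or_eq_top W' with h | h
    · left
      refine (Submodule.eq_bot_iff W).mpr fun x hx => ?_
      have : x ∈ W' := hx
      rw [h] at this
      exact this
    · right
      refine Submodule.eq_top_iff'.mpr fun x => ?_
      have : x ∈ W' := h ▸ Submodule.mem_top
      exact this
  · intro hfin
    have hl1 : ∀ n : ℕ, l • (r ^ (n + 1) • e) = r ^ n • e := fun n => by
      rw [smul_smul]; exact hmk _ _ (hlr n)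
    have hl0 : l • e = 0 := by
      have := hmk l 0 (by rw [hl, map_zero, LinearMap.zero_apply])
      rwa [zero_smul] at this
    have hpow : ∀ n i : ℕ, l ^ n • (r ^ (n + i) • e) = r ^ i • e := by
      intro n
      induction n with
      | zero => intro i; rw [pow_zero, one_smul, zero_add]
      | succ n ih =>
        intro i
        rw [pow_succ, mul_smul, show n + 1 + i = (n + i) + 1 by ring, hl1, ih]
    have hpow0 : ∀ i n : ℕ, i < n → l ^ n • (r ^ i • e) = 0 := by
      intro i n hin
      obtain ⟨j, rfl⟩ := Nat.exists_eq_add_of_lt hin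
      have := hpow i 0
      rw [add_zero, pow_zero, one_smul] at this
      rw [show i + j + 1 = j + 1 + i by ring, pow_add, mul_smul, this, pow_succ, mul_smul, hl0,
        smul_zero]
    let f : ℕ → Representation.invariants (ρ.comp H.subtype) := fun n => ⟨r ^ n • e, fun h => by
      change ρ h (r ^ n • e) = _
      rw [hρ, smul_smul]
      refine hmk _ _ ?_
      rw [map_mul, Module.End.mul_apply, MonoidAlgebra.of_apply,
          Representation.asAlgebraHom_single, one_smul]
      exact hfix n h h.2⟩
    have hind : LinearIndependent k f := by
      refine LinearIndependent.of_comp (Submodule.subtype _) ?_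
      rw [linearIndependent_iff']
      intro s c hs
      by_contra! hcon
      obtain ⟨i0, hi0, hci0⟩ := hcon
      let s' := s.filter fun i => c i ≠ 0
      have hs' : s'.Nonempty := ⟨i0, Finset.mem_filter.mpr ⟨hi0, hci0⟩⟩
      obtain ⟨hM, hcM⟩ := Finset.mem_filter.mp (s'.max'_mem hs')
      set M := s'.max' hs'
      have h1 := congrArg (fun x : V => l ^ M • x) hs
      simp only [Finset.smul_sum, smul_zero] at h1
      rw [Finset.sum_eq_single M] at h1
      · have h2 : l ^ M • c M • (r ^ M • e) = c M • e := by
          rw [smul_comm, show r ^ M = r ^ (M + 0) by rw [add_zero], hpow, pow_zero, one_smul]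
        exact he0 ((smul_eq_zero.mp (h2.symm.trans h1)).resolve_left hcM)
      · intro i hi hiM
        change l ^ M • c i • (r ^ i • e) = 0
        by_cases hci : c i = 0
        · rw [hci, zero_smul, smul_zero]
        · have : i ≤ M := s'.le_max' i (Finset.mem_filter.mpr ⟨hi, hci⟩)
          rw [smul_comm, hpow0 i M (lt_of_le_of_ne this hiM), smul_zero]
      · exact fun h => absurd hM h
    have := hind.lt_aleph0_of_finiteDimensional
    simp at this

theorem exists_compatible_family {k G K D₀ D₁ : Type*} [Field k] [Group G] [Group K]
    [AddCommGroup D₀] [Module k D₀] [AddCommGroup D₁] [Module k D₁] (ρ : Representation k K D₀)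
    (j : K →* G) (hj : Function.Injective j) (ϖ : G) (c : K) (hϖ : ϖ * ϖ = j c)
    (i : D₁ →ₗ[k] D₀) (hi : Function.Injective i) (P : D₁ →ₗ[k] D₁)
    (hP : ∀ x, P (P x) = x) (hc : ∀ x, ρ c (i x) = i x)
    (hI : ∀ κ κ' : K, j κ * ϖ = ϖ * j κ' →
      ∀ x, ∃ y, ρ κ' (i x) = i y ∧ ρ κ (i (P x)) = i (P y))
    (d : G → ℕ) (hd1 : d 1 = 0) (hdK : ∀ g κ, d (g * j κ) = d g)
    (hd0 : ∀ g, d g = 0 → ∃ κ, g = j κ)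
    (hdlt : ∀ g, d g ≠ 0 → ∃ κ, d (g * j κ * ϖ) < d g)
    (huniq : ∀ g κ κ', d (g * j κ * ϖ) < d g → d (g * j κ' * ϖ) < d g →
      ∃ κ'', j κ'' * ϖ = ϖ * j (κ⁻¹ * κ'))
    (hne : ∀ g, d (g * ϖ) ≠ d g) :
    ∃ lam : G → (D₀ →ₗ[k] D₀), lam 1 = LinearMap.id ∧
      (∀ g κ x, lam (g * j κ) x = lam g (ρ κ x)) ∧
      (∀ g x, lam (g * ϖ) (i x) = lam g (i (P x))) := by
  classical
  obtain ⟨π, hπ⟩ := i.exists_leftInverse_of_injective (LinearMap.ker_eq_bot.mpr hi)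
  have hπ' : ∀ x, π (i x) = x := fun x => LinearMap.congr_fun hπ x
  obtain ⟨s, hs1, hs2⟩ : ∃ s : G → G, (∀ g, ∃ κ, g = s g * j κ) ∧ ∀ g κ, s (g * j κ) = s g := by
    refine ⟨fun g => (Quotient.out (QuotientGroup.mk g : G ⧸ j.range)), fun g => ?_, fun g κ => ?_⟩
    · obtain ⟨⟨_, κ, rfl⟩, hh⟩ := QuotientGroup.mk_out_eq_mul j.range g
      exact ⟨κ⁻¹, by simp only [hh]; simp⟩
    · have : (QuotientGroup.mk (g * j κ) : G ⧸ j.range) = QuotientGroup.mk g :=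
        QuotientGroup.mk_mul_of_mem g ⟨κ, rfl⟩
      simp only [this]
  choose t ht using hs1
  have htK : ∀ g κ, t (g * j κ) = t g * κ := by
    intro g κ
    apply hj
    have h := ht (g * j κ)
    rw [hs2] at h
    rw [map_mul]
    have h2 := ht g
    nth_rewrite 1 [h2] at h
    rw [mul_assoc] at h
    exact (mul_left_cancel h).symm
  have hds : ∀ g, d (s g) = d g := fun g => by
    conv_rhs => rw [ht g]
    rw [hdK]
  have hdlt' : ∀ g, ∃ κ, d g ≠ 0 → d (g * j κ * ϖ) < d g := fun g => by
    by_cases h : d g = 0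
    · exact ⟨1, fun h' => absurd h h'⟩
    · obtain ⟨κ, hκ⟩ := hdlt g h
      exact ⟨κ, fun _ => hκ⟩
  choose a ha using hdlt'
  have hd0' : ∀ g, ∃ κ, d g = 0 → g = j κ := fun g => by
    by_cases h : d g = 0
    · obtain ⟨κ, hκ⟩ := hd0 g h
      exact ⟨κ, fun _ => hκ⟩
    · exact ⟨1, fun h' => absurd h' h⟩
  choose b hb using hd0'
  let lam : G → (D₀ →ₗ[k] D₀) := WellFounded.fix (measure d).wf fun g rec =>
    if h : d g = 0 then ρ (b g)
    else (rec (s g * j (a (s g)) * ϖ)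
      (by
        change d _ < d g
        have := ha (s g) (by rwa [hds])
        rwa [hds g] at this)) ∘ₗ i ∘ₗ P ∘ₗ π ∘ₗ ρ ((a (s g))⁻¹ * t g)
  have lam0 : ∀ g, d g = 0 → lam g = ρ (b g) := fun g h => by
    simp only [lam]
    rw [WellFounded.fix_eq, dif_pos h]
  have lamS : ∀ g, d g ≠ 0 → lam g =
      (lam (s g * j (a (s g)) * ϖ)) ∘ₗ i ∘ₗ P ∘ₗ π ∘ₗ ρ ((a (s g))⁻¹ * t g) := fun g h => by
    simp only [lam]
    rw [WellFounded.fix_eq, dif_neg h]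
  have hK : ∀ g κ x, lam (g * j κ) x = lam g (ρ κ x) := by
    intro g κ x
    by_cases h : d g = 0
    · have h' : d (g * j κ) = 0 := by rw [hdK, h]
      rw [lam0 _ h, lam0 _ h']
      have : b (g * j κ) = b g * κ := by
        apply hj
        rw [← hb _ h', map_mul, ← hb _ h]
      rw [this, map_mul]; rfl
    · have h' : d (g * j κ) ≠ 0 := by rwa [hdK]
      rw [lamS _ h, lamS _ h', hs2, htK, ← mul_assoc, map_mul]; rfl
  have hcinv : ∀ x, ρ c⁻¹ (i x) = i x := fun x => by
    nth_rewrite 1 [← hc x]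
    rw [← Module.End.mul_apply, ← map_mul]
    simp
  have hup : ∀ g x, d g < d (g * ϖ) → lam (g * ϖ) (i x) = lam g (i (P x)) := by
    intro g x hlt
    have h0 : d (g * ϖ) ≠ 0 := by omega
    have h1 := ht (g * ϖ)
    set r := s (g * ϖ) with hr
    have hdr : d r = d (g * ϖ) := hds _
    have h2 : d (r * j (t (g * ϖ)) * ϖ) < d r := by
      rw [← h1, mul_assoc, hϖ, hdK, hdr]; exact hlt
    have h3 := ha r (by rwa [hdr])
    obtain ⟨κ'', hκ⟩ := huniq r _ _ h3 h2
    obtain ⟨y, hy1, hy2⟩ := hI _ _ hκ x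
    rw [lamS _ h0]
    simp only [LinearMap.comp_apply]
    rw [← hr, hy1, hπ']
    have hg : g = r * j (a r) * ϖ * j (c⁻¹ * κ'') := by
      have e1 : j κ'' = ϖ * j ((a r)⁻¹ * t (g * ϖ)) * ϖ⁻¹ := by rw [← hκ]; group
      rw [map_mul, e1, map_inv, ← hϖ, map_mul, map_inv]
      calc g = (g * ϖ) * ϖ⁻¹ := by group
        _ = r * j (t (g * ϖ)) * ϖ⁻¹ := by rw [← h1]
        _ = _ := by group
    have hP' : ρ (c⁻¹ * κ'') (i (P x)) = i (P y) := by
      rw [map_mul, Module.End.mul_apply, hy2, hcinv]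
    rw [← hP', ← hK, ← hg]
  refine ⟨lam, ?_, hK, ?_⟩
  · rw [lam0 1 hd1]
    have : b 1 = 1 := hj (by rw [← hb 1 hd1, map_one])
    rw [this, map_one]; rfl
  · intro g x
    rcases lt_or_gt_of_ne (hne g) with h | h
    · have h1 : d (g * ϖ) < d (g * ϖ * ϖ) := by rwa [mul_assoc, hϖ, hdK]
      have := hup (g * ϖ) (P x) h1
      rw [mul_assoc, hϖ, hK, hc, hP] at this
      exact this.symm
    · exact hup g x h

theorem exists_amalgam_embedding {k G K D₀ D₁ : Type*} [Field k] [Group G] [Group K]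
    [AddCommGroup D₀] [Module k D₀] [AddCommGroup D₁] [Module k D₁] (ρ : Representation k K D₀)
    (j : K →* G) (hj : Function.Injective j) (ϖ : G) (c : K) (hϖ : ϖ * ϖ = j c)
    (i : D₁ →ₗ[k] D₀) (hi : Function.Injective i) (P : D₁ →ₗ[k] D₁)
    (hP : ∀ x, P (P x) = x) (hc : ∀ x, ρ c (i x) = i x)
    (hI : ∀ κ κ' : K, j κ * ϖ = ϖ * j κ' →
      ∀ x, ∃ y, ρ κ' (i x) = i y ∧ ρ κ (i (P x)) = i (P y))
    (d : G → ℕ) (hd1 : d 1 = 0) (hdK : ∀ g κ, d (g * j κ) = d g)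
    (hd0 : ∀ g, d g = 0 → ∃ κ, g = j κ)
    (hdlt : ∀ g, d g ≠ 0 → ∃ κ, d (g * j κ * ϖ) < d g)
    (huniq : ∀ g κ κ', d (g * j κ * ϖ) < d g → d (g * j κ' * ϖ) < d g →
      ∃ κ'', j κ'' * ϖ = ϖ * j (κ⁻¹ * κ'))
    (hne : ∀ g, d (g * ϖ) ≠ d g) :
    ∃ (R : Representation k G (G → D₀)) (Φ : D₀ →ₗ[k] (G → D₀)), Function.Injective Φ ∧
      (∀ κ x, R (j κ) (Φ x) = Φ (ρ κ x)) ∧ (∀ x, R ϖ (Φ (i x)) = Φ (i (P x))) := by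
  obtain ⟨lam, h1, hK, hlϖ⟩ := exists_compatible_family ρ j hj ϖ c hϖ i hi P hP hc hI d hd1 hdK hd0
    hdlt huniq hne
  refine ⟨{ toFun := fun g => LinearMap.funLeft k D₀ (fun h => h * g)
            map_one' := by ext; simp [LinearMap.funLeft_apply]
            map_mul' := fun a b => by
              ext; simp [LinearMap.funLeft_apply, mul_assoc] }, LinearMap.pi lam, ?_, ?_, ?_⟩
  · intro x y hxy
    have := congrFun hxy 1
    simpa [LinearMap.pi_apply, h1] using this
  · intro κ x
    funext h
    exact hK h κ x
  · intro x
    funext h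
    exact hlϖ h x

/-- A surjection `r : O → 𝔽` modelling reduction modulo `p` from the unramified quadratic
extension of `ℤ_p` onto the field with `p ^ 2` elements. -/
structure IsQuadraticReduction (p : ℕ) {O 𝔽 : Type*} [CommRing O] [Field 𝔽] [Fintype 𝔽]
    (r : O →+* 𝔽) : Prop where
  card_eq : Fintype.card 𝔽 = p ^ 2
  surjective : Function.Surjective r
  map_p : r (p : O) = 0
  dvd_of_map_eq_zero : ∀ x, r x = 0 → (p : O) ∣ x
  regular : ∀ x : O, (p : O) * x = 0 → x = 0
  isUnit_of_map_ne_zero : ∀ x, r x ≠ 0 → IsUnit x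

/-- The Witt cocycle `((x + y) ^ p - x ^ p - y ^ p) / p`. -/
def wittCocycle (p : ℕ) {R : Type*} [CommRing R] (x y : R) : R :=
  ∑ k ∈ Finset.Ioo 0 p, x ^ k * y ^ (p - k) * ((p.choose k / p : ℕ) : R)

theorem map_wittCocycle (p : ℕ) {R S : Type*} [CommRing R] [CommRing S] (f : R →+* S) (x y : R) :
    f (wittCocycle p x y) = wittCocycle p (f x) (f y) := by
  simp [wittCocycle]

section Theta

variable {p : ℕ} {O 𝔽 : Type*} [CommRing O] [Field 𝔽] [Fintype 𝔽]
  {r : O →+* 𝔽}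

open Classical in
/-- The reduction of `(x - x ^ (p ^ 2)) / p`. -/
noncomputable def theta (p : ℕ) (r : O →+* 𝔽) (x : O) : 𝔽 :=
  if h : ∃ y, x = x ^ (p ^ 2) + p * y then r h.choose else 0

namespace IsQuadraticReduction

variable (hr : IsQuadraticReduction p r)
include hr

theorem theta_eq {x y : O} (h : x = x ^ (p ^ 2) + p * y) : theta p r x = r y := by
  have h' : ∃ y, x = x ^ (p ^ 2) + p * y := ⟨y, h⟩
  rw [theta, dif_pos h']
  have h2 := h'.choose_spec
  have h3 : (p : O) * (h'.choose - y) = 0 := by linear_combination h - h2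
  have := hr.regular _ h3
  rw [sub_eq_zero] at this
  rw [this]

theorem exists_theta (x : O) : ∃ y, x = x ^ (p ^ 2) + p * y ∧ theta p r x = r y := by
  have : r (x - x ^ (p ^ 2)) = 0 := by
    rw [map_sub, map_pow, ← hr.card_eq, FiniteField.pow_card, sub_self]
  obtain ⟨y, hy⟩ := hr.dvd_of_map_eq_zero _ this
  have h : x = x ^ (p ^ 2) + p * y := by linear_combination hy
  exact ⟨y, h, hr.theta_eq h⟩

theorem theta_mul (x y : O) : theta p r (x * y) = r x * theta p r y + r y * theta p r x := by
  obtain ⟨X, hX, hX'⟩ := hr.exists_theta x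
  obtain ⟨Y, hY, hY'⟩ := hr.exists_theta y
  rw [hr.theta_eq (y := y * X + x ^ (p ^ 2) * Y)
    (by rw [mul_pow]; linear_combination y * hX + x ^ (p ^ 2) * hY), hX', hY']
  rw [map_add, map_mul, map_mul, map_pow, ← hr.card_eq, FiniteField.pow_card]
  ring

theorem theta_one : theta p r 1 = 0 := by
  rw [hr.theta_eq (y := 0), map_zero]; simp

theorem theta_add_p_mul (x y : O) : theta p r (x + p * y) = theta p r x + r y := by
  obtain ⟨X, hX, hX'⟩ := hr.exists_theta x
  obtain ⟨w, hw⟩ := dvd_sub_pow_of_dvd_sub (R := O) (p := p) (a := x + p * y) (b := x)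
    ⟨y, by ring⟩ 2
  rw [hr.theta_eq (y := X + y - p ^ 2 * w) (by linear_combination hX - hw), hX']
  simp [hr.map_p]

/-- A lift with vanishing `theta`. -/
theorem exists_lift : ∃ τ : 𝔽 → O, ∀ t, r (τ t) = t ∧ theta p r (τ t) = 0 := by
  refine ⟨fun t => Function.surjInv hr.surjective t ^ p ^ 2, fun t => ⟨?_, ?_⟩⟩
  · rw [map_pow, Function.surjInv_eq hr.surjective, ← hr.card_eq, FiniteField.pow_card]
  · set x := Function.surjInv hr.surjective t
    obtain ⟨X, hX, hX'⟩ := hr.exists_theta x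
    obtain ⟨w, hw⟩ := dvd_sub_pow_of_dvd_sub (R := O) (p := p) (a := x) (b := x ^ p ^ 2)
      ⟨X, by linear_combination hX⟩ 2
    rw [hr.theta_eq (y := p ^ 2 * w) (by linear_combination hw)]
    simp [hr.map_p]

variable [Fact p.Prime]

theorem theta_zero : theta p r 0 = 0 := by
  rw [hr.theta_eq (y := 0), map_zero]
  simp [(Fact.out : p.Prime).ne_zero]

theorem theta_add (x y : O) : theta p r (x + y) =
    theta p r x + theta p r y - wittCocycle p (r x ^ p) (r y ^ p) := by
  obtain ⟨X, hX, hX'⟩ := hr.exists_theta x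
  obtain ⟨Y, hY, hY'⟩ := hr.exists_theta y
  have h1 := add_pow_prime_eq' (Fact.out : p.Prime) x y
  obtain ⟨w, hw⟩ := dvd_sub_pow_of_dvd_sub (R := O) (p := p) (a := (x + y) ^ p) (b := x ^ p + y ^ p)
    ⟨wittCocycle p x y, by rw [h1, wittCocycle]; ring⟩ 1
  have h2 := add_pow_prime_eq' (Fact.out : p.Prime) (x ^ p) (y ^ p)
  change _ = _ + (p : O) * wittCocycle p (x ^ p) (y ^ p) at h2
  rw [pow_one, h2] at hw
  simp only [← pow_mul, ← pow_two] at hw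
  rw [hr.theta_eq (y := X + Y - wittCocycle p (x ^ p) (y ^ p) - p * w)
    (by linear_combination hX + hY - hw)]
  simp [hX', hY', map_wittCocycle, hr.map_p]

end IsQuadraticReduction

end Theta

section PowerSums

variable {p : ℕ} {𝔽 : Type*} [Field 𝔽] [Fintype 𝔽]

open Polynomial

theorem sum_eval_eq_neg_coeff (Q : 𝔽[X])
    (hQ : Q.natDegree < 2 * (Fintype.card 𝔽 - 1)) :
    ∑ t, Q.eval (t) = - Q.coeff (Fintype.card 𝔽 - 1) := by
  classical
  have hcard : 1 < Fintype.card 𝔽 := Fintype.one_lt_card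
  have hpow : ∀ n, n < 2 * (Fintype.card 𝔽 - 1) →
      ∑ t : 𝔽, t ^ n = if n = Fintype.card 𝔽 - 1 then -1 else 0 := by
    intro n hn
    by_cases h0 : n < Fintype.card 𝔽 - 1
    · rw [FiniteField.sum_pow_lt_card_sub_one _ _ h0, if_neg h0.ne]
    · obtain ⟨m, rfl⟩ := Nat.exists_eq_add_of_le (not_lt.mp h0)
      by_cases hm : m = 0
      · subst hm
        have : ∀ t : 𝔽, t ^ (Fintype.card 𝔽 - 1 + 0) = 1 - if t = 0 then 1 else 0 := by
          intro t
          by_cases ht : t = 0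
          · rw [if_pos ht, ht, zero_pow (by omega), sub_self]
          · rw [if_neg ht, add_zero, FiniteField.pow_card_sub_one_eq_one t ht, sub_zero]
        rw [Finset.sum_congr rfl fun t _ => this t]
        simp
      · have : ∀ t : 𝔽, t ^ (Fintype.card 𝔽 - 1 + m) = t ^ m := by
          intro t
          by_cases ht : t = 0
          · rw [ht, zero_pow (by omega), zero_pow hm]
          · rw [pow_add, FiniteField.pow_card_sub_one_eq_one t ht, one_mul]
        rw [Finset.sum_congr rfl fun t _ => this t, if_neg (by omega),
          FiniteField.sum_pow_lt_card_sub_one _ _ (by omega)]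
  calc ∑ t, Q.eval (t)
      = ∑ t, ∑ n ∈ Finset.range (2 * (Fintype.card 𝔽 - 1)), Q.coeff n * t ^ n :=
        Finset.sum_congr rfl fun t _ => Polynomial.eval_eq_sum_range' hQ _
    _ = ∑ n ∈ Finset.range (2 * (Fintype.card 𝔽 - 1)), Q.coeff n * ∑ t, t ^ n := by
        rw [Finset.sum_comm]
        simp [Finset.mul_sum]
    _ = ∑ n ∈ Finset.range (2 * (Fintype.card 𝔽 - 1)),
          Q.coeff n * if n = Fintype.card 𝔽 - 1 then -1 else 0 :=
        Finset.sum_congr rfl fun n hn => by rw [hpow n (Finset.mem_range.mp hn)]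
    _ = _ := by
        simp only [mul_ite, mul_zero, mul_neg, mul_one, Finset.sum_ite_eq', Finset.mem_range]
        rw [if_pos (by omega)]

theorem sum_eval_eq_zero (hcard : Fintype.card 𝔽 = p ^ 2) (Q : 𝔽[X])
    (hQ : Q.natDegree < p ^ 2 - 1) : ∑ t, Q.eval (t) = 0 := by
  rw [sum_eval_eq_neg_coeff Q (by rw [hcard]; omega), hcard,
    coeff_eq_zero_of_natDegree_lt hQ, neg_zero]

variable [Fact p.Prime]

/-- A polynomial sum over the field with `p ^ 2` elements with separated `p`-adic digits. -/
theorem sum_eval_mul_eval_pow (hcard : Fintype.card 𝔽 = p ^ 2) (A H : 𝔽[X])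
    (hA : A.natDegree < p) (hAH : A.natDegree + p * H.natDegree < 2 * (p ^ 2 - 1)) :
    ∑ t, A.eval (t) * H.eval (t ^ p) = - (A.coeff (p - 1) * H.coeff (p - 1)) := by
  have hp : 0 < p := (Fact.out : p.Prime).pos
  have h := sum_eval_eq_neg_coeff (A * expand 𝔽 p H) (by
    rw [hcard]
    refine lt_of_le_of_lt natDegree_mul_le ?_
    rw [natDegree_expand, mul_comm H.natDegree]
    exact hAH)
  simp only [eval_mul, expand_eval] at h
  rw [h, hcard, coeff_mul, Finset.sum_eq_single (p - 1, p * (p - 1))]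
  · rw [mul_comm p, coeff_expand_mul hp]
  · rintro ⟨a, b⟩ hab hne
    rw [Finset.HasAntidiagonal.mem_antidiagonal] at hab
    simp only at hab ⊢
    by_cases ha : A.natDegree < a
    · rw [coeff_eq_zero_of_natDegree_lt ha, zero_mul]
    · rw [coeff_expand hp]
      split_ifs with hb
      · exfalso
        obtain ⟨m, rfl⟩ := hb
        apply hne
        obtain ⟨n, rfl⟩ : ∃ n, p = n + 1 := ⟨p - 1, by omega⟩
        have h1 : a + (n + 1) * m = (n + 1) * n + n := by
          rw [hab]; ring_nf; omega
        have h2 : m = n := by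
          apply le_antisymm
          · by_contra! hlt
            nlinarith
          · by_contra! hlt
            nlinarith
        subst h2
        simp only [Nat.add_sub_cancel, Prod.mk.injEq, and_true]
        omega
      · rw [mul_zero]
  · intro h
    exfalso
    apply h
    rw [Finset.HasAntidiagonal.mem_antidiagonal]
    obtain ⟨n, rfl⟩ : ∃ n, p = n + 1 := ⟨p - 1, by omega⟩
    simp only [Nat.add_sub_cancel]
    ring_nf
    omega

end PowerSums

section LocalFunctions

variable {p : ℕ} {O 𝔽 : Type*} [CommRing O] [Field 𝔽] [Fintype 𝔽]

/-- The Wronskian-type expression attached to the derivation-like map `theta`. -/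
noncomputable def thetaBracket (p : ℕ) (r : O →+* 𝔽) (x y : O) : 𝔽 :=
  r x * theta p r y - r y * theta p r x

/-- The function `z` on column vectors. -/
noncomputable def zAux (p : ℕ) (r : O →+* 𝔽) (x y : O) : 𝔽 :=
  r x ^ ((p + 1) * (p - 2)) * thetaBracket p r x y ^ p

def vFun (p : ℕ) (r : O →+* 𝔽) (κ : Matrix (Fin 2) (Fin 2) O) : 𝔽 := r (κ 0 0) ^ (p + 1)

def wFun (p : ℕ) (r : O →+* 𝔽) (κ : Matrix (Fin 2) (Fin 2) O) : 𝔽 := r (κ 0 0) * r (κ 0 1) ^ p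

def uFun (p : ℕ) (r : O →+* 𝔽) (κ : Matrix (Fin 2) (Fin 2) O) : 𝔽 :=
  r κ.det ^ (p + 1) * r (κ 0 0) ^ ((p + 1) * (p - 2))

noncomputable def zFun (p : ℕ) (r : O →+* 𝔽) (κ : Matrix (Fin 2) (Fin 2) O) : 𝔽 :=
  r κ.det * zAux p r (κ 0 0) (κ 1 0)

noncomputable def fFun (p : ℕ) (r : O →+* 𝔽) (τ : 𝔽 → O) (κ : Matrix (Fin 2) (Fin 2) O) : 𝔽 :=
  r κ.det * ∑ t, zAux p r (κ 0 1 + τ t * κ 0 0) (κ 1 1 + τ t * κ 1 0)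

def gFun (p : ℕ) (r : O →+* 𝔽) (κ : Matrix (Fin 2) (Fin 2) O) : 𝔽 :=
  r κ.det * r (κ 0 0) ^ (p - 2 + p * (p - 1)) * r (κ 1 0) ^ p

def eFun (p : ℕ) (r : O →+* 𝔽) (κ : Matrix (Fin 2) (Fin 2) O) : 𝔽 :=
  r κ.det * r (κ 0 0) ^ (p - 1)

namespace IsQuadraticReduction

variable {r : O →+* 𝔽} (hr : IsQuadraticReduction p r)
include hr

theorem pow_sq (x : 𝔽) : x ^ p ^ 2 = x := by
  rw [← hr.card_eq, FiniteField.pow_card]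

theorem pow_p_pow_p (x : 𝔽) : (x ^ p) ^ p = x := by
  rw [← pow_mul, ← pow_two, hr.pow_sq]

theorem pow_add_sq (x : 𝔽) (hx : x ≠ 0) {m n : ℕ} (h : m = n + (p ^ 2 - 1)) : x ^ m = x ^ n := by
  rw [h, pow_add, ← hr.card_eq, FiniteField.pow_card_sub_one_eq_one x hx, mul_one]

theorem map_mul_iwahori_zero_zero (κ : Matrix (Fin 2) (Fin 2) O) (α β γ δ : O) :
    r ((κ * !![α, β; p * γ, δ]) 0 0) = r (κ 0 0) * r α := by
  simp [Matrix.mul_apply, Fin.sum_univ_two, hr.map_p]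

theorem map_mul_iwahori_one_zero (κ : Matrix (Fin 2) (Fin 2) O) (α β γ δ : O) :
    r ((κ * !![α, β; p * γ, δ]) 1 0) = r (κ 1 0) * r α := by
  simp [Matrix.mul_apply, Fin.sum_univ_two, hr.map_p]

set_option linter.unusedSectionVars false in
theorem map_mul_iwahori_zero_one (κ : Matrix (Fin 2) (Fin 2) O) (α β γ δ : O) :
    r ((κ * !![α, β; p * γ, δ]) 0 1) = r (κ 0 0) * r β + r (κ 0 1) * r δ := by
  simp [Matrix.mul_apply, Fin.sum_univ_two]

theorem map_det_mul_iwahori (κ : Matrix (Fin 2) (Fin 2) O) (α β γ δ : O) :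
    r (κ * !![α, β; p * γ, δ]).det = r κ.det * (r α * r δ) := by
  simp [Matrix.det_fin_two_of, hr.map_p]

theorem thetaBracket_mul (x y u : O) :
    thetaBracket p r (u * x) (u * y) = r u ^ 2 * thetaBracket p r x y := by
  simp only [thetaBracket, hr.theta_mul, map_mul]
  ring

theorem thetaBracket_add (x y s t : O) :
    thetaBracket p r (x + p * s) (y + p * t) = thetaBracket p r x y + r x * r t - r y * r s := by
  simp only [thetaBracket, hr.theta_add_p_mul, map_add, map_mul, hr.map_p]
  ring

theorem vFun_iwahori (κ : Matrix (Fin 2) (Fin 2) O) (α β γ δ : O) :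
    vFun p r (κ * !![α, β; p * γ, δ]) = r α ^ (p + 1) * vFun p r κ := by
  rw [vFun, vFun, hr.map_mul_iwahori_zero_zero, mul_pow, mul_comm]

variable [hp : Fact p.Prime]

theorem charP : CharP 𝔽 p := charP_of_card_eq_prime_pow hr.card_eq

theorem add_pow_p (x y : 𝔽) : (x + y) ^ p = x ^ p + y ^ p := by
  have := hr.charP
  exact add_pow_char x y p

theorem sub_pow_p (x y : 𝔽) : (x - y) ^ p = x ^ p - y ^ p := by
  have := hr.charP
  exact sub_pow_char x y

theorem wFun_iwahori (κ : Matrix (Fin 2) (Fin 2) O) (α β γ δ : O) :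
    wFun p r (κ * !![α, β; p * γ, δ]) =
      r α * r δ ^ p * wFun p r κ + r α * r β ^ p * vFun p r κ := by
  rw [wFun, hr.map_mul_iwahori_zero_zero, hr.map_mul_iwahori_zero_one, hr.add_pow_p, wFun, vFun,
    mul_pow, mul_pow]
  ring

theorem uFun_iwahori (κ : Matrix (Fin 2) (Fin 2) O) (α β γ δ : O) (hα : r α ≠ 0) :
    uFun p r (κ * !![α, β; p * γ, δ]) = r δ ^ (p + 1) * uFun p r κ := by
  have h : r α ^ (p + 1) * r α ^ ((p + 1) * (p - 2)) = 1 := by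
    rw [← pow_add]
    refine (hr.pow_add_sq _ hα (n := 0) ?_).trans (pow_zero _)
    obtain ⟨m, hm⟩ := Nat.exists_eq_add_of_le' hp.out.two_le
    simp only [hm, Nat.add_sub_cancel]
    ring_nf
    omega
  rw [uFun, hr.map_mul_iwahori_zero_zero, hr.map_det_mul_iwahori, uFun]
  simp only [mul_pow]
  linear_combination (r κ.det ^ (p + 1) * r (κ 0 0) ^ ((p + 1) * (p - 2)) * r δ ^ (p + 1)) * h

theorem zFun_iwahori (κ : Matrix (Fin 2) (Fin 2) O) (α β γ δ : O) (hα : r α ≠ 0) :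
    zFun p r (κ * !![α, β; p * γ, δ]) =
      r δ * r α ^ p * zFun p r κ + r δ * r γ ^ p * uFun p r κ := by
  have h : r α * r α ^ ((p + 1) * (p - 2)) * (r α ^ 2) ^ p = r α ^ p := by
    rw [← pow_mul, ← pow_succ', ← pow_add]
    refine hr.pow_add_sq _ hα ?_
    obtain ⟨m, hm⟩ := Nat.exists_eq_add_of_le' hp.out.two_le
    simp only [hm, Nat.add_sub_cancel]
    ring_nf
    omega
  have h2 : r α * r α ^ ((p + 1) * (p - 2)) * r α ^ p = 1 := by
    rw [← pow_succ', ← pow_add]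
    refine (hr.pow_add_sq _ hα (n := 0) ?_).trans (pow_zero _)
    obtain ⟨m, hm⟩ := Nat.exists_eq_add_of_le' hp.out.two_le
    simp only [hm, Nat.add_sub_cancel]
    ring_nf
    omega
  have h3 : thetaBracket p r ((κ * !![α, β; p * γ, δ]) 0 0) ((κ * !![α, β; p * γ, δ]) 1 0) =
      r α ^ 2 * thetaBracket p r (κ 0 0) (κ 1 0) + r γ * r α * r κ.det := by
    have e1 : (κ * !![α, β; p * γ, δ]) 0 0 = α * κ 0 0 + p * (κ 0 1 * γ) := by
      simp [Matrix.mul_apply, Fin.sum_univ_two]; ring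
    have e2 : (κ * !![α, β; p * γ, δ]) 1 0 = α * κ 1 0 + p * (κ 1 1 * γ) := by
      simp [Matrix.mul_apply, Fin.sum_univ_two]; ring
    rw [e1, e2, hr.thetaBracket_add, hr.thetaBracket_mul, Matrix.det_fin_two]
    simp only [map_mul, map_sub]
    ring
  rw [zFun, hr.map_det_mul_iwahori, zAux, h3, hr.map_mul_iwahori_zero_zero, zFun, uFun, zAux,
    hr.add_pow_p]
  simp only [mul_pow]
  linear_combination (r κ.det * r δ * r (κ 0 0) ^ ((p + 1) * (p - 2)) *
    thetaBracket p r (κ 0 0) (κ 1 0) ^ p) * h +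
    (r κ.det ^ (p + 1) * r δ * r (κ 0 0) ^ ((p + 1) * (p - 2)) * r γ ^ p) * h2

theorem gFun_iwahori (κ : Matrix (Fin 2) (Fin 2) O) (α β γ δ : O) (hα : r α ≠ 0) :
    gFun p r (κ * !![α, β; p * γ, δ]) = r δ * r α ^ p * gFun p r κ := by
  have h : r α * r α ^ (p - 2 + p * (p - 1)) * r α ^ p = r α ^ p := by
    rw [← pow_succ', ← pow_add]
    refine hr.pow_add_sq _ hα ?_
    obtain ⟨m, hm⟩ := Nat.exists_eq_add_of_le' hp.out.two_le
    simp only [hm, Nat.add_sub_cancel, show m + 2 - 1 = m + 1 by omega]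
    ring_nf
    omega
  rw [gFun, hr.map_mul_iwahori_zero_zero, hr.map_det_mul_iwahori, hr.map_mul_iwahori_one_zero, gFun]
  simp only [mul_pow]
  linear_combination (r κ.det * r δ * r (κ 0 0) ^ (p - 2 + p * (p - 1)) * r (κ 1 0) ^ p) * h

theorem eFun_iwahori (κ : Matrix (Fin 2) (Fin 2) O) (α β γ δ : O) :
    eFun p r (κ * !![α, β; p * γ, δ]) = r δ * r α ^ p * eFun p r κ := by
  rw [eFun, hr.map_mul_iwahori_zero_zero, hr.map_det_mul_iwahori, eFun, mul_pow]
  have h : r α ^ p = r α * r α ^ (p - 1) := by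
    rw [← pow_succ', Nat.sub_add_cancel hp.out.one_le]
  rw [h]
  ring

theorem zAux_mul (x y u : O) (hu : r u ≠ 0) :
    zAux p r (u * x) (u * y) = r u ^ (p - 1) * zAux p r x y := by
  rw [zAux, hr.thetaBracket_mul, zAux, map_mul, mul_pow, mul_pow]
  have h : r u ^ ((p + 1) * (p - 2)) * (r u ^ 2) ^ p = r u ^ (p - 1) := by
    rw [← pow_mul, ← pow_add]
    refine hr.pow_add_sq _ hu ?_
    obtain ⟨m, hm⟩ := Nat.exists_eq_add_of_le' hp.out.two_le
    simp only [hm, Nat.add_sub_cancel, show m + 2 - 1 = m + 1 by omega]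
    ring_nf
    omega
  linear_combination (r x ^ ((p + 1) * (p - 2)) * thetaBracket p r x y ^ p) * h

theorem zAux_add (x y s t : O) :
    zAux p r (x + p * s) (y + p * t) =
      zAux p r x y + r x ^ ((p + 1) * (p - 2)) * (r x * r t - r y * r s) ^ p := by
  rw [zAux, hr.thetaBracket_add, zAux, map_add, map_mul, hr.map_p, zero_mul, add_zero, add_sub_assoc,
    hr.add_pow_p]
  ring

theorem wittCocycle_pow (x y : 𝔽) : wittCocycle p (x ^ p) (y ^ p) ^ p = wittCocycle p x y := by
  have := hr.charP
  have h := map_wittCocycle p (frobenius 𝔽 p) (x ^ p) (y ^ p)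
  simp only [frobenius_def, hr.pow_p_pow_p] at h
  exact h

end IsQuadraticReduction

end LocalFunctions

section Equivariance

variable {p : ℕ} [hp : Fact p.Prime] {O 𝔽 : Type*} [CommRing O] [Field 𝔽] [Fintype 𝔽]

namespace IsQuadraticReduction

open Polynomial

variable {r : O →+* 𝔽} (hr : IsQuadraticReduction p r)
include hr

theorem sum_wittCocycle_mul_pow (A B P Q : 𝔽) :
    ∑ t, wittCocycle p B (A * t) * (Q * t + P) ^ ((p + 1) * (p - 2)) = 0 := by
  have h := sum_eval_eq_zero hr.card_eq
    (wittCocycle p (C B) (C A * X) * (C Q * X + C P) ^ ((p + 1) * (p - 2))) (by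
      have h1 : (wittCocycle p (C B) (C A * X)).natDegree ≤ p - 1 := by
        refine natDegree_sum_le_of_forall_le _ _ fun i hi => ?_
        rw [Finset.mem_Ioo] at hi
        refine natDegree_mul_le.trans ?_
        rw [natDegree_natCast, add_zero, ← C_pow]
        refine (natDegree_C_mul_le _ _).trans ?_
        refine (natDegree_pow_le_of_le _ (natDegree_C_mul_le A X)).trans ?_
        rw [natDegree_X]
        omega
      have h2 : ((C Q * X + C P) ^ ((p + 1) * (p - 2))).natDegree ≤ (p + 1) * (p - 2) := by
        refine (natDegree_pow_le_of_le _ natDegree_linear_le).trans ?_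
        rw [mul_one]
      refine lt_of_le_of_lt (natDegree_mul_le_of_le h1 h2) ?_
      obtain ⟨m, hm⟩ := Nat.exists_eq_add_of_le' hp.out.two_le
      simp only [hm, Nat.add_sub_cancel, show m + 2 - 1 = m + 1 by omega]
      ring_nf
      omega)
  rw [← h]
  refine Finset.sum_congr rfl fun t _ => ?_
  have := map_wittCocycle p (evalRingHom t) (C B) (C A * X)
  simp only [coe_evalRingHom, eval_mul, eval_C, eval_X] at this
  simp only [eval_mul, eval_pow, eval_add, eval_C, eval_X, this]

theorem sum_quadratic_mul_pow (H : 𝔽[X]) (hH : H.natDegree ≤ 2) (P Q : 𝔽) :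
    ∑ t, H.eval (t ^ p) * (Q * t + P) ^ ((p + 1) * (p - 2)) = 0 := by
  have hA : ((C Q * X + C P) ^ (p - 2)).natDegree ≤ p - 2 := by
    refine (natDegree_pow_le_of_le _ natDegree_linear_le).trans ?_
    rw [mul_one]
  have hB : (H * (C (Q ^ p) * X + C (P ^ p)) ^ (p - 2)).natDegree ≤ 2 + (p - 2) := by
    refine natDegree_mul_le_of_le hH ?_
    refine (natDegree_pow_le_of_le _ natDegree_linear_le).trans ?_
    rw [mul_one]
  have h2 := hp.out.two_le
  have h := sum_eval_mul_eval_pow (p := p) hr.card_eq ((C Q * X + C P) ^ (p - 2))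
    (H * (C (Q ^ p) * X + C (P ^ p)) ^ (p - 2)) (by omega) (by
      refine lt_of_le_of_lt (add_le_add hA (Nat.mul_le_mul_left p hB)) ?_
      obtain ⟨m, hm⟩ := Nat.exists_eq_add_of_le' hp.out.two_le
      simp only [hm, Nat.add_sub_cancel]
      ring_nf
      have : 0 < m * m + 1 := by positivity
      have : m * m = m ^ 2 := by ring
      omega)
  rw [coeff_eq_zero_of_natDegree_lt (p := (C Q * X + C P) ^ (p - 2)) (by omega), zero_mul,
    neg_zero] at h
  rw [← h]
  refine Finset.sum_congr rfl fun t _ => ?_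
  simp only [eval_mul, eval_pow, eval_add, eval_C, eval_X]
  rw [show (p + 1) * (p - 2) = (p - 2) + p * (p - 2) by ring, pow_add, pow_mul, hr.add_pow_p,
    mul_pow]
  ring

theorem fFun_iwahori (τ : 𝔽 → O) (hτ : ∀ t, r (τ t) = t ∧ theta p r (τ t) = 0)
    (κ : Matrix (Fin 2) (Fin 2) O) (α β γ δ : O) (hα : r α ≠ 0) (hδ : r δ ≠ 0) :
    fFun p r τ (κ * !![α, β; p * γ, δ]) = r α * r δ ^ p * fFun p r τ κ := by
  set σ : 𝔽 → 𝔽 := fun t => (r β + t * r α) / r δ with hσ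
  have hσδ : ∀ t, σ t * r δ = r β + t * r α := fun t => div_mul_cancel₀ _ hδ
  have hσb : Function.Bijective σ := by
    rw [← Finite.injective_iff_bijective]
    intro s t hst
    have h : σ s * r δ = σ t * r δ := by rw [hst]
    rw [hσδ, hσδ] at h
    exact mul_right_cancel₀ hα (add_left_cancel h)
  have hε : ∀ t, ∃ ε, β + α * τ t = (δ + p * γ * τ t) * (τ (σ t) + p * ε) ∧
      r δ * r ε = theta p r β + t * theta p r α - wittCocycle p (r β ^ p) ((r α * t) ^ p)
        - σ t * (theta p r δ + r γ * t) := by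
    intro t
    have hu : r (δ + p * γ * τ t) = r δ := by simp [hr.map_p]
    obtain ⟨u, huu⟩ := hr.isUnit_of_map_ne_zero (δ + p * γ * τ t) (by rwa [hu])
    obtain ⟨e, he⟩ := hr.dvd_of_map_eq_zero (β + α * τ t - (δ + p * γ * τ t) * τ (σ t)) (by
      rw [map_sub, map_mul, hu, map_add, map_mul, (hτ _).1, (hτ _).1]
      linear_combination - hσδ t)
    have h1 : β + α * τ t = (δ + p * γ * τ t) * (τ (σ t) + p * (↑u⁻¹ * e)) := by
      have : (δ + p * γ * τ t) * ↑u⁻¹ = 1 := by rw [← huu, Units.mul_inv]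
      linear_combination he - p * e * this
    refine ⟨_, h1, ?_⟩
    have h2 := congrArg (theta p r) h1
    rw [hr.theta_add, hr.theta_mul, hr.theta_mul, hr.theta_add_p_mul, hu, map_mul, (hτ _).1,
      (hτ _).2, (hτ _).2, map_add, (hτ _).1, show δ + p * γ * τ t = δ + p * (γ * τ t) by ring,
      hr.theta_add_p_mul, map_mul r γ, (hτ _).1, map_mul r (p : O), hr.map_p] at h2
    linear_combination - h2
  choose ε hε1 hε2 using hε
  have hterm : ∀ t, zAux p r ((κ * !![α, β; p * γ, δ]) 0 1 + τ t * (κ * !![α, β; p * γ, δ]) 0 0)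
      ((κ * !![α, β; p * γ, δ]) 1 1 + τ t * (κ * !![α, β; p * γ, δ]) 1 0) =
      r δ ^ (p - 1) * (zAux p r (κ 0 1 + τ (σ t) * κ 0 0) (κ 1 1 + τ (σ t) * κ 1 0) -
        r κ.det ^ p * (r (ε t) ^ p * (r (κ 0 1) + σ t * r (κ 0 0)) ^ ((p + 1) * (p - 2)))) := by
    intro t
    have e1 : (κ * !![α, β; p * γ, δ]) 0 1 + τ t * (κ * !![α, β; p * γ, δ]) 0 0 =
        (δ + p * γ * τ t) * (κ 0 1 + τ (σ t) * κ 0 0 + p * (ε t * κ 0 0)) := by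
      simp only [Matrix.mul_apply, Fin.sum_univ_two, Matrix.of_apply, Matrix.cons_val',
        Matrix.cons_val_zero, Matrix.cons_val_one, Matrix.cons_val_fin_one]
      linear_combination κ 0 0 * hε1 t
    have e2 : (κ * !![α, β; p * γ, δ]) 1 1 + τ t * (κ * !![α, β; p * γ, δ]) 1 0 =
        (δ + p * γ * τ t) * (κ 1 1 + τ (σ t) * κ 1 0 + p * (ε t * κ 1 0)) := by
      simp only [Matrix.mul_apply, Fin.sum_univ_two, Matrix.of_apply, Matrix.cons_val',
        Matrix.cons_val_zero, Matrix.cons_val_one, Matrix.cons_val_fin_one]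
      linear_combination κ 1 0 * hε1 t
    have hu : r (δ + p * γ * τ t) = r δ := by simp [hr.map_p]
    have e3 : (r (κ 0 1) + σ t * r (κ 0 0)) * (r (ε t) * r (κ 1 0)) -
        (r (κ 1 1) + σ t * r (κ 1 0)) * (r (ε t) * r (κ 0 0)) = 0 - r κ.det * r (ε t) := by
      rw [Matrix.det_fin_two]
      simp only [map_sub, map_mul]
      ring
    rw [e1, e2, hr.zAux_mul _ _ _ (by rwa [hu]), hr.zAux_add, hu]
    simp only [map_add, map_mul, (hτ _).1]
    rw [e3, hr.sub_pow_p, zero_pow hp.out.ne_zero, mul_pow]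
    ring
  have herr : ∑ t, r (ε t) ^ p * (r (κ 0 1) + σ t * r (κ 0 0)) ^ ((p + 1) * (p - 2)) = 0 := by
    have hne : r δ ^ p * r δ ^ ((p + 1) * (p - 2)) ≠ 0 :=
      mul_ne_zero (pow_ne_zero _ hδ) (pow_ne_zero _ hδ)
    refine (mul_eq_zero.mp ?_).resolve_left hne
    have hq := hr.sum_quadratic_mul_pow (C (theta p r β ^ p) + C (theta p r α ^ p) * X -
      C ((r δ ^ p)⁻¹) * (C (r β ^ p) + C (r α ^ p) * X) *
        (C (theta p r δ ^ p) + C (r γ ^ p) * X)) (by compute_degree)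
        (r δ * r (κ 0 1) + r β * r (κ 0 0)) (r α * r (κ 0 0))
    have hw := hr.sum_wittCocycle_mul_pow (r α) (r β)
        (r δ * r (κ 0 1) + r β * r (κ 0 0)) (r α * r (κ 0 0))
    refine Eq.trans ?_ ((congrArg₂ (fun x y => x - y) hq hw).trans (sub_zero 0))
    rw [Finset.mul_sum, ← Finset.sum_sub_distrib]
    refine Finset.sum_congr rfl fun t _ => ?_
    have h1 : r δ ^ p * r (ε t) ^ p = theta p r β ^ p + t ^ p * theta p r α ^ p -
        wittCocycle p (r β) (r α * t) - σ t ^ p * (theta p r δ ^ p + r γ ^ p * t ^ p) := by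
      rw [← mul_pow, hε2, hr.sub_pow_p, hr.sub_pow_p, hr.wittCocycle_pow, hr.add_pow_p, mul_pow,
        mul_pow, hr.add_pow_p, mul_pow]
    have h2 : σ t ^ p = (r δ ^ p)⁻¹ * (r β ^ p + r α ^ p * t ^ p) := by
      rw [hσ]
      simp only
      rw [div_pow, hr.add_pow_p, mul_pow]
      ring
    have h3 : r α * r (κ 0 0) * t + (r δ * r (κ 0 1) + r β * r (κ 0 0)) =
        r δ * (r (κ 0 1) + σ t * r (κ 0 0)) := by
      linear_combination - r (κ 0 0) * hσδ t
    rw [h3, mul_pow]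
    simp only [eval_mul, eval_add, eval_sub, eval_C, eval_X]
    rw [h2] at h1
    linear_combination (r δ ^ ((p + 1) * (p - 2)) *
      (r (κ 0 1) + σ t * r (κ 0 0)) ^ ((p + 1) * (p - 2))) * h1
  rw [fFun, hr.map_det_mul_iwahori, Finset.sum_congr rfl fun t _ => hterm t, ← Finset.mul_sum,
    Finset.sum_sub_distrib, ← Finset.mul_sum, herr, mul_zero, sub_zero, fFun,
    ← hσb.sum_comp (fun t => zAux p r (κ 0 1 + τ t * κ 0 0) (κ 1 1 + τ t * κ 1 0))]
  have h : r δ ^ p = r δ * r δ ^ (p - 1) := by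
    rw [← pow_succ', Nat.sub_add_cancel hp.out.one_le]
  rw [h]
  ring

end IsQuadraticReduction

end Equivariance

section Operators

section

variable {p : ℕ} {O 𝔽 : Type*} [CommRing O] [Field 𝔽] {r : O →+* 𝔽}

theorem map_mul_weyl_zero_zero (τ : 𝔽 → O) (hτ : ∀ t, r (τ t) = t)
    (κ : Matrix (Fin 2) (Fin 2) O) (t : 𝔽) :
    r ((κ * !![τ t, -1; 1, 0]) 0 0) = r (κ 0 0) * t + r (κ 0 1) := by
  simp [Matrix.mul_apply, Fin.sum_univ_two, hτ]

theorem map_mul_weyl_one_zero (τ : 𝔽 → O) (hτ : ∀ t, r (τ t) = t)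
    (κ : Matrix (Fin 2) (Fin 2) O) (t : 𝔽) :
    r ((κ * !![τ t, -1; 1, 0]) 1 0) = r (κ 1 0) * t + r (κ 1 1) := by
  simp [Matrix.mul_apply, Fin.sum_univ_two, hτ]

theorem sum_zFun [Fintype 𝔽] (τ : 𝔽 → O) (κ : Matrix (Fin 2) (Fin 2) O) :
    ∑ t, zFun p r (κ * !![τ t, -1; 1, 0]) = fFun p r τ κ := by
  rw [fFun, Finset.mul_sum]
  refine Finset.sum_congr rfl fun t _ => ?_
  have e1 : (κ * !![τ t, -1; 1, 0]) 0 0 = κ 0 1 + τ t * κ 0 0 := by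
    simp [Matrix.mul_apply, Fin.sum_univ_two]; ring
  have e2 : (κ * !![τ t, -1; 1, 0]) 1 0 = κ 1 1 + τ t * κ 1 0 := by
    simp [Matrix.mul_apply, Fin.sum_univ_two]; ring
  rw [zFun, e1, e2, Matrix.det_mul, Matrix.det_fin_two_of]
  simp

end

variable {p : ℕ} [hp : Fact p.Prime] {O 𝔽 : Type*} [CommRing O] [Field 𝔽] [Fintype 𝔽]

namespace IsQuadraticReduction

open Polynomial

variable {r : O →+* 𝔽} (hr : IsQuadraticReduction p r)
include hr

theorem sum_vFun (τ : 𝔽 → O) (hτ : ∀ t, r (τ t) = t) (κ : Matrix (Fin 2) (Fin 2) O) :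
    ∑ t, - t ^ (p ^ 2 - 1 - p) * vFun p r (κ * !![1, 0; τ t, 1]) = wFun p r κ := by
  set a := r (κ 0 0) with ha
  set b := r (κ 0 1) with hb
  have h2 := hp.out.two_le
  have hpp : p * 2 ≤ p ^ 2 := by nlinarith
  have h := sum_eval_eq_neg_coeff (X ^ (p ^ 2 - 1 - p) *
    (C (a * a ^ p) + C (b * a ^ p) * X + C (a * b ^ p) * X ^ p + C (b * b ^ p) * X ^ (p + 1))) (by
      refine lt_of_le_of_lt (natDegree_mul_le_of_le (natDegree_X_pow_le _)
        (show _ ≤ p + 1 from ?_)) ?_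
      · compute_degree
      · rw [hr.card_eq]; omega)
  rw [hr.card_eq, coeff_X_pow_mul', if_pos (by omega),
    show p ^ 2 - 1 - (p ^ 2 - 1 - p) = p by omega] at h
  have hc : (C (a * a ^ p) + C (b * a ^ p) * X + C (a * b ^ p) * X ^ p +
      C (b * b ^ p) * X ^ (p + 1)).coeff p = a * b ^ p := by
    simp only [coeff_add, coeff_C_mul, coeff_X_pow, coeff_X, coeff_C]
    rw [if_neg (by omega), if_neg (by omega), if_pos trivial, if_neg (by omega)]
    ring
  rw [hc] at h
  rw [wFun, ← neg_eq_iff_eq_neg.mpr h, ← Finset.sum_neg_distrib]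
  refine Finset.sum_congr rfl fun t _ => ?_
  have e1 : r ((κ * !![1, 0; τ t, 1]) 0 0) = a + b * t := by
    simp [Matrix.mul_apply, Fin.sum_univ_two, hτ, ha, hb]
  rw [vFun, e1, pow_succ (a + b * t), hr.add_pow_p, mul_pow]
  simp only [eval_mul, eval_add, eval_pow, eval_C, eval_X]
  ring

theorem sum_eFun (τ : 𝔽 → O) (hτ : ∀ t, r (τ t) = t) (κ : Matrix (Fin 2) (Fin 2) O) :
    ∑ t, - t * eFun p r (κ * !![τ t, -1; 1, 0]) = 0 := by
  have h := sum_eval_eq_zero hr.card_eq (C (- r κ.det) * X *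
    (C (r (κ 0 0)) * X + C (r (κ 0 1))) ^ (p - 1)) (by
      have h2 := hp.out.two_le
      have hpp : p * 2 ≤ p ^ 2 := by nlinarith
      refine lt_of_le_of_lt (natDegree_mul_le_of_le (natDegree_C_mul_le _ _)
        (natDegree_pow_le_of_le _ natDegree_linear_le)) ?_
      rw [natDegree_X]
      omega)
  rw [← h]
  refine Finset.sum_congr rfl fun t _ => ?_
  rw [eFun, map_mul_weyl_zero_zero τ hτ, Matrix.det_mul, Matrix.det_fin_two_of]
  simp only [eval_mul, eval_add, eval_pow, eval_C, eval_X]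
  simp
  ring

theorem coeff_linear_pow_mul (hodd : Odd p) (a b c d : 𝔽) :
    ((C a * X + C b) ^ (p - 1) * (C c * X + C d)).coeff (p - 1) = a ^ (p - 2) * (a * d - b * c) := by
  have h3 : 3 ≤ p := by
    have := hp.out.two_le
    obtain ⟨m, hm⟩ := hodd
    omega
  by_cases ha : a = 0
  · subst ha
    rw [map_zero, zero_mul, zero_add, ← C_pow, coeff_C_mul, coeff_add, coeff_C_mul, coeff_X,
      coeff_C, if_neg (by omega), if_neg (by omega), zero_pow (by omega)]
    ring
  · have := hr.charP
    have h1 : C a * ((C a * X + C b) ^ (p - 1) * (C c * X + C d)) =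
        C c * (C (a ^ p) * X ^ p + C (b ^ p)) + C (a * d - b * c) * (C a * X + C b) ^ (p - 1) := by
      have h2 : C (a ^ p) * X ^ p + C (b ^ p) = (C a * X + C b) ^ (p - 1) * (C a * X + C b) := by
        rw [← pow_succ, Nat.sub_add_cancel (by omega), add_pow_char, mul_pow, C_pow, C_pow]
      rw [h2]
      simp only [map_sub, map_mul]
      ring
    have h2 := congrArg (fun q => coeff q (p - 1)) h1
    simp only [coeff_C_mul, coeff_add, coeff_X_pow, coeff_C] at h2
    have h4 : ((C a * X + C b) ^ (p - 1)).coeff (p - 1) = a ^ (p - 1) := by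
      have := coeff_pow_of_natDegree_le (p := C a * X + C b) (n := 1) (m := p - 1)
        natDegree_linear_le
      rw [mul_one] at this
      rw [this]
      simp
    rw [if_neg (by omega), if_neg (by omega), h4] at h2
    refine mul_left_cancel₀ ha (h2.trans ?_)
    rw [show p - 1 = p - 2 + 1 by omega, pow_succ]
    ring

theorem sum_gFun (hodd : Odd p) (τ : 𝔽 → O) (hτ : ∀ t, r (τ t) = t)
    (κ : Matrix (Fin 2) (Fin 2) O) :
    ∑ t, - t * gFun p r (κ * !![τ t, -1; 1, 0]) = uFun p r κ := by
  set a := r (κ 0 0) with ha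
  set b := r (κ 0 1) with hb
  set c := r (κ 1 0) with hc
  set d := r (κ 1 1) with hd
  have h3 : 3 ≤ p := by
    have := hp.out.two_le
    obtain ⟨m, hm⟩ := hodd
    omega
  have hA : (X * (C a * X + C b) ^ (p - 2)).natDegree ≤ p - 1 := by
    refine (natDegree_mul_le_of_le natDegree_X_le
      (natDegree_pow_le_of_le _ natDegree_linear_le)).trans ?_
    omega
  have hH : ((C (a ^ p) * X + C (b ^ p)) ^ (p - 1) * (C (c ^ p) * X + C (d ^ p))).natDegree ≤ p := by
    refine (natDegree_mul_le_of_le (natDegree_pow_le_of_le _ natDegree_linear_le)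
      natDegree_linear_le).trans ?_
    omega
  have h := sum_eval_mul_eval_pow hr.card_eq (X * (C a * X + C b) ^ (p - 2))
    ((C (a ^ p) * X + C (b ^ p)) ^ (p - 1) * (C (c ^ p) * X + C (d ^ p))) (by omega) (by
      refine lt_of_le_of_lt (add_le_add hA (Nat.mul_le_mul_left p hH)) ?_
      have : p * 3 ≤ p * p := Nat.mul_le_mul_left p h3
      rw [pow_two]
      omega)
  rw [hr.coeff_linear_pow_mul hodd, show p - 1 = p - 2 + 1 by omega, coeff_X_mul] at h
  have h4 : ((C a * X + C b) ^ (p - 2)).coeff (p - 2) = a ^ (p - 2) := by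
    have := coeff_pow_of_natDegree_le (p := C a * X + C b) (n := 1) (m := p - 2)
      natDegree_linear_le
    rw [mul_one] at this
    rw [this]
    simp
  rw [h4, show p - 2 + 1 = p - 1 by omega] at h
  have hdet : r κ.det = a * d - b * c := by
    rw [Matrix.det_fin_two]
    simp [ha, hb, hc, hd]
  have hdetp : r κ.det ^ p = a ^ p * d ^ p - b ^ p * c ^ p := by
    rw [hdet, hr.sub_pow_p, mul_pow, mul_pow]
  rw [uFun, ← ha]
  have h5 : a ^ ((p + 1) * (p - 2)) = a ^ (p - 2) * (a ^ p) ^ (p - 2) := by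
    rw [← pow_mul, ← pow_add]; ring_nf
  rw [h5]
  have h6 : ∑ t, - t * gFun p r (κ * !![τ t, -1; 1, 0]) = - r κ.det *
      ∑ t, eval t (X * (C a * X + C b) ^ (p - 2)) *
        eval (t ^ p) ((C (a ^ p) * X + C (b ^ p)) ^ (p - 1) * (C (c ^ p) * X + C (d ^ p))) := by
    rw [Finset.mul_sum]
    refine Finset.sum_congr rfl fun t _ => ?_
    rw [gFun, map_mul_weyl_zero_zero τ hτ, map_mul_weyl_one_zero τ hτ, Matrix.det_mul,
      Matrix.det_fin_two_of]
    simp only [eval_mul, eval_add, eval_pow, eval_C, eval_X]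
    rw [pow_add, pow_mul, hr.add_pow_p, hr.add_pow_p]
    simp only [mul_pow, ← ha, ← hb, ← hc, ← hd]
    simp
    ring
  rw [h6, h, ← hdetp]
  ring

theorem fFun_lower (τ : 𝔽 → O) (hτ : ∀ t, r (τ t) = t ∧ theta p r (τ t) = 0) (γ : O) :
    fFun p r τ !![1, 0; p * γ, 1] = 0 := by
  have h2 := hp.out.two_le
  have h := sum_eval_eq_neg_coeff (C (r γ ^ p) * X ^ (p ^ 2 + p - 2)) (by
      refine lt_of_le_of_lt (natDegree_C_mul_X_pow_le _ _) ?_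
      rw [hr.card_eq]
      have : p * 2 ≤ p ^ 2 := by nlinarith
      omega)
  rw [hr.card_eq, coeff_C_mul, coeff_X_pow, if_neg (by
    have : p * 2 ≤ p ^ 2 := by nlinarith
    omega), mul_zero, neg_zero] at h
  rw [fFun]
  refine mul_eq_zero_of_right _ ?_
  rw [← h]
  refine Finset.sum_congr rfl fun t _ => ?_
  have e : zAux p r ((0 : O) + τ t * 1) (1 + τ t * (p * γ)) =
      t ^ ((p + 1) * (p - 2)) * (t * (t * r γ)) ^ p := by
    rw [zAux, thetaBracket, show (1 : O) + τ t * (p * γ) = 1 + p * (τ t * γ) by ring,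
      hr.theta_add_p_mul, hr.theta_one]
    simp [hτ]
  have e2 : t ^ ((p + 1) * (p - 2)) * (t * t) ^ p = t ^ (p ^ 2 + p - 2) := by
    rw [← pow_two, ← pow_mul, ← pow_add]
    congr 1
    obtain ⟨m, hm⟩ := Nat.exists_eq_add_of_le' hp.out.two_le
    simp only [hm, Nat.add_sub_cancel]
    ring_nf
    omega
  simp only [eval_mul, eval_pow, eval_C, eval_X]
  refine Eq.trans e ?_
  rw [← e2]
  simp only [mul_pow]
  ring

theorem fFun_lower_one (hodd : Odd p) (τ : 𝔽 → O) (hτ : ∀ t, r (τ t) = t ∧ theta p r (τ t) = 0) :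
    fFun p r τ !![1, 0; 1, 1] = 1 := by
  have h3 : 3 ≤ p := by
    have := hp.out.two_le
    obtain ⟨m, hm⟩ := hodd
    omega
  have hpp : p * 3 ≤ p ^ 2 := by nlinarith
  have h : ∑ t : 𝔽, ∑ k ∈ Finset.Ioo 0 p, t ^ (p ^ 2 - 2) * (t ^ (p - k) *
      ((p.choose k / p : ℕ) : 𝔽)) = -1 := by
    rw [Finset.sum_comm, Finset.sum_eq_single (p - 1)]
    · have := sum_eval_eq_neg_coeff (X ^ (p ^ 2 - 1) : 𝔽[X]) (by
        refine lt_of_le_of_lt (natDegree_X_pow_le _) ?_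
        rw [hr.card_eq]; omega)
      rw [hr.card_eq, coeff_X_pow, if_pos rfl] at this
      rw [← this]
      refine Finset.sum_congr rfl fun t _ => ?_
      have hch : p.choose (p - 1) / p = 1 := by
        rw [Nat.choose_symm_of_eq_add (b := 1) (by omega), Nat.choose_one_right,
          Nat.div_self (by omega)]
      rw [hch, eval_pow, eval_X, Nat.cast_one, mul_one, ← pow_add]
      congr 1
      omega
    · intro k hk hk'
      rw [Finset.mem_Ioo] at hk
      have := sum_eval_eq_neg_coeff
        (C ((p.choose k / p : ℕ) : 𝔽) * X ^ (p ^ 2 - 2 + (p - k)) : 𝔽[X]) (by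
        refine lt_of_le_of_lt (natDegree_C_mul_X_pow_le _ _) ?_
        rw [hr.card_eq]; omega)
      rw [hr.card_eq, coeff_C_mul, coeff_X_pow, if_neg (by omega), mul_zero, neg_zero] at this
      rw [← this]
      refine Finset.sum_congr rfl fun t _ => ?_
      simp only [eval_mul, eval_pow, eval_C, eval_X]
      rw [pow_add]
      ring
    · intro h
      exact absurd (Finset.mem_Ioo.mpr ⟨by omega, by omega⟩) h
  have hdet : r (!![1, 0; 1, 1] : Matrix (Fin 2) (Fin 2) O).det = 1 := by
    simp [Matrix.det_fin_two_of]
  rw [fFun, hdet, one_mul, ← neg_neg (1 : 𝔽), ← h, ← Finset.sum_neg_distrib]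
  refine Finset.sum_congr rfl fun t _ => ?_
  have e : zAux p r ((0 : O) + τ t * 1) (1 + τ t * 1) =
      t ^ ((p + 1) * (p - 2)) * (- (t ^ p * wittCocycle p 1 t)) := by
    have hw := hr.wittCocycle_pow 1 t
    rw [one_pow] at hw
    rw [zAux, thetaBracket, zero_add, mul_one, hr.theta_add, hr.theta_one, (hτ t).1, (hτ t).2,
      map_one, one_pow, ← hw, mul_zero, sub_zero, add_zero, zero_sub, mul_neg,
      (hp.out.odd_of_ne_two (by omega)).neg_pow, mul_pow]
  refine Eq.trans e ?_
  rw [mul_neg, ← mul_assoc, ← pow_add, wittCocycle, Finset.mul_sum]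
  congr 1
  refine Finset.sum_congr rfl fun k _ => ?_
  have e2 : (p + 1) * (p - 2) + p = p ^ 2 - 2 := by
    obtain ⟨m, hm⟩ := Nat.exists_eq_add_of_le' hp.out.two_le
    simp only [hm, Nat.add_sub_cancel]
    ring_nf
    omega
  rw [e2, one_pow, one_mul]

theorem zFun_lower (γ : O) : zFun p r !![1, 0; p * γ, 1] = r γ ^ p := by
  have h := hr.theta_add_p_mul 0 γ
  rw [hr.theta_zero, zero_add, zero_add] at h
  simp [zFun, zAux, thetaBracket, h, hr.theta_one, Matrix.det_fin_two_of]

end IsQuadraticReduction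

end Operators

section Datum

variable {p : ℕ} {O 𝔽 k M : Type*} [CommRing O] [Field 𝔽] [Fintype 𝔽] [Field k]
  [AddCommGroup M] [Module k M]

/-- Right translation on functions on a group. -/
def rightTranslation (k G X : Type*) [Field k] [Group G] [AddCommGroup X] [Module k X] :
    Representation k G (G → X) where
  toFun g := LinearMap.funLeft k X fun h => h * g
  map_one' := by ext; simp [LinearMap.funLeft_apply]
  map_mul' a b := by ext; simp [LinearMap.funLeft_apply, mul_assoc]

theorem rightTranslation_apply {k G X : Type*} [Field k] [Group G] [AddCommGroup X] [Module k X]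
    (g h : G) (φ : G → X) : rightTranslation k G X g φ h = φ (h * g) := rfl

noncomputable def datumFun (p : ℕ) (r : O →+* 𝔽) (τ : 𝔽 → O) (ι : 𝔽 →+* k) (S T : M →ₗ[k] M)
    (w : (Fin 5 → M) × (Fin 5 → M)) (κ : Matrix (Fin 2) (Fin 2) O) : Fin 4 → M :=
  ![ι (uFun p r κ) • w.2 0 + ι (zFun p r κ) • w.2 1 + ι (zFun p r κ ^ p) • w.2 2 +
      ι (fFun p r τ κ) • w.1 3 + ι (fFun p r τ κ ^ p) • w.1 4 +
      ι (gFun p r κ) • S (w.2 3) + ι (gFun p r κ ^ p) • T (w.2 4),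
    ι (vFun p r κ) • w.1 0 + ι (wFun p r κ) • w.1 1 + ι (wFun p r κ ^ p) • w.1 2,
    ι (eFun p r κ) • w.2 3, ι (eFun p r κ ^ p) • w.2 4]

noncomputable def datumMap (p : ℕ) (r : O →+* 𝔽) (τ : 𝔽 → O) (ι : 𝔽 →+* k) (S T : M →ₗ[k] M) :
    ((Fin 5 → M) × (Fin 5 → M)) →ₗ[k] (GL (Fin 2) O → Fin 4 → M) where
  toFun w κ := datumFun p r τ ι S T w κ
  map_add' x y := by
    funext κ s
    fin_cases s <;> simp [datumFun] <;> module
  map_smul' c x := by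
    funext κ s
    fin_cases s <;> simp [datumFun] <;> module

theorem datumMap_apply (r : O →+* 𝔽) (τ : 𝔽 → O) (ι : 𝔽 →+* k) (S T : M →ₗ[k] M)
    (w : (Fin 5 → M) × (Fin 5 → M)) (κ : GL (Fin 2) O) :
    datumMap p r τ ι S T w κ = datumFun p r τ ι S T w κ := rfl

/-- The action of the Iwahori subgroup on the parameters of `datumMap`. -/
def iwahoriAct (p : ℕ) (ι : 𝔽 →+* k) (α β δ : 𝔽) (x : Fin 5 → M) : Fin 5 → M :=
  ![ι (α ^ (p + 1)) • x 0 + ι (α * β ^ p) • x 1 + ι (α ^ p * β) • x 2, ι (α * δ ^ p) • x 1,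
    ι (α ^ p * δ) • x 2, ι (α * δ ^ p) • x 3, ι (α ^ p * δ) • x 4]

/-- A unipotent lower triangular matrix. -/
noncomputable def lowerGL (x : O) : GL (Fin 2) O :=
  Matrix.GeneralLinearGroup.mk'' !![1, 0; x, 1] (by simp [Matrix.det_fin_two_of])

/-- A unipotent upper triangular matrix times the Weyl element. -/
noncomputable def upperWeylGL (x : O) : GL (Fin 2) O :=
  Matrix.GeneralLinearGroup.mk'' !![x, -1; 1, 0] (by simp [Matrix.det_fin_two_of])

theorem coe_lowerGL (x : O) : (lowerGL x : Matrix (Fin 2) (Fin 2) O) = !![1, 0; x, 1] := rfl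

theorem coe_upperWeylGL (x : O) : (upperWeylGL x : Matrix (Fin 2) (Fin 2) O) = !![x, -1; 1, 0] :=
  rfl

namespace IsQuadraticReduction

variable {r : O →+* 𝔽} (hr : IsQuadraticReduction p r) [hp : Fact p.Prime]
include hr

omit hp in
theorem vFun_pow (κ : Matrix (Fin 2) (Fin 2) O) : vFun p r κ ^ p = vFun p r κ := by
  rw [vFun, ← pow_mul, show (p + 1) * p = p ^ 2 + p by ring, pow_add, hr.pow_sq, pow_succ']

omit hp in
theorem uFun_pow (κ : Matrix (Fin 2) (Fin 2) O) : uFun p r κ ^ p = uFun p r κ := by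
  have h (x : 𝔽) : (x ^ (p + 1)) ^ p = x ^ (p + 1) := by
    rw [← pow_mul, show (p + 1) * p = p ^ 2 + p by ring, pow_add, hr.pow_sq, pow_succ']
  rw [uFun, pow_mul, mul_pow, h, pow_right_comm, h]

theorem datumFun_iwahori (τ : 𝔽 → O) (hτ : ∀ t, r (τ t) = t ∧ theta p r (τ t) = 0)
    (ι : 𝔽 →+* k) (S T : M →ₗ[k] M) (x y : Fin 5 → M) (κ : Matrix (Fin 2) (Fin 2) O)
    (α β γ δ : O) (hα : r α ≠ 0) (hδ : r δ ≠ 0) :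
    datumFun p r τ ι S T (x, y) (κ * !![α, β; p * γ, δ]) =
      datumFun p r τ ι S T (iwahoriAct p ι (r α) (r β) (r δ) x,
        iwahoriAct p ι (r δ) (r γ) (r α) y) κ := by
  funext s
  have hu := hr.uFun_pow κ
  have hv := hr.vFun_pow κ
  fin_cases s
  · simp only [datumFun, iwahoriAct, hr.uFun_iwahori _ _ _ _ _ hα, hr.zFun_iwahori _ _ _ _ _ hα,
      hr.fFun_iwahori τ hτ _ _ _ _ _ hα hδ, hr.gFun_iwahori _ _ _ _ _ hα, hr.add_pow_p, mul_pow,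
      hr.pow_p_pow_p, hu]
    simp [map_mul, map_add, map_pow]
    module
  · simp only [datumFun, iwahoriAct, hr.vFun_iwahori, hr.wFun_iwahori, hr.add_pow_p, mul_pow,
      hr.pow_p_pow_p, hv]
    simp [map_mul, map_add, map_pow]
    module
  · simp only [datumFun, iwahoriAct, hr.eFun_iwahori]
    simp [map_mul, map_pow]
    module
  · simp only [datumFun, iwahoriAct, hr.eFun_iwahori, mul_pow, hr.pow_p_pow_p]
    simp [map_mul, map_pow]
    module

omit hp in
theorem map_ne_zero_of_coe_eq (h : GL (Fin 2) O) (α β γ δ : O)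
    (hh : (h : Matrix (Fin 2) (Fin 2) O) = !![α, β; p * γ, δ]) : r α ≠ 0 ∧ r δ ≠ 0 := by
  have h1 : IsUnit (r (h : Matrix (Fin 2) (Fin 2) O).det) :=
    ((Matrix.isUnit_iff_isUnit_det _).mp h.isUnit).map r
  rw [hh, Matrix.det_fin_two_of] at h1
  have h2 := h1.ne_zero
  simp only [map_sub, map_mul, hr.map_p, zero_mul, mul_zero, sub_zero] at h2
  exact ⟨left_ne_zero_of_mul h2, right_ne_zero_of_mul h2⟩

theorem rightTranslation_datumMap (τ : 𝔽 → O) (hτ : ∀ t, r (τ t) = t ∧ theta p r (τ t) = 0)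
    (ι : 𝔽 →+* k) (S T : M →ₗ[k] M) (h : GL (Fin 2) O) (α β γ δ : O)
    (hh : (h : Matrix (Fin 2) (Fin 2) O) = !![α, β; p * γ, δ]) (x y : Fin 5 → M) :
    rightTranslation k _ _ h (datumMap p r τ ι S T (x, y)) =
      datumMap p r τ ι S T (iwahoriAct p ι (r α) (r β) (r δ) x,
        iwahoriAct p ι (r δ) (r γ) (r α) y) := by
  obtain ⟨hα, hδ⟩ := hr.map_ne_zero_of_coe_eq h α β γ δ hh
  funext κ
  rw [rightTranslation_apply, datumMap_apply, datumMap_apply, Units.val_mul, hh,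
    hr.datumFun_iwahori τ hτ ι S T x y _ α β γ δ hα hδ]

theorem sum_lowerGL_datumMap (τ : 𝔽 → O) (hτ : ∀ t, r (τ t) = t) (ι : 𝔽 →+* k)
    (S T : M →ₗ[k] M) (m : M) :
    ∑ t, ι (- t ^ (p ^ 2 - 1 - p)) • rightTranslation k _ _ (lowerGL (τ t))
      (datumMap p r τ ι S T (Pi.single 0 m, 0)) = datumMap p r τ ι S T (Pi.single 1 m, 0) := by
  funext κ s
  simp only [Finset.sum_apply, Pi.smul_apply, rightTranslation_apply, datumMap_apply,
    Units.val_mul, coe_lowerGL]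
  fin_cases s
  · simp [datumFun]
  · simp [datumFun, map_sum, Finset.sum_smul, smul_smul, -Finset.sum_neg_distrib, ← hr.sum_vFun τ hτ]
  · simp [datumFun]
  · simp [datumFun]

theorem sum_lowerGL_datumMap_pow (τ : 𝔽 → O) (hτ : ∀ t, r (τ t) = t) (ι : 𝔽 →+* k)
    (S T : M →ₗ[k] M) (m : M) :
    ∑ t, ι ((- t ^ (p ^ 2 - 1 - p)) ^ p) • rightTranslation k _ _ (lowerGL (τ t))
      (datumMap p r τ ι S T (Pi.single 0 m, 0)) = datumMap p r τ ι S T (Pi.single 2 m, 0) := by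
  have := hr.charP
  have hs (κ : Matrix (Fin 2) (Fin 2) O) : ∑ t, (- t ^ (p ^ 2 - 1 - p)) ^ p *
      vFun p r (κ * !![1, 0; τ t, 1]) = wFun p r κ ^ p := by
    rw [← hr.sum_vFun τ hτ, sum_pow_char]
    refine Finset.sum_congr rfl fun t _ => ?_
    rw [mul_pow, hr.vFun_pow]
  funext κ s
  simp only [Finset.sum_apply, Pi.smul_apply, rightTranslation_apply, datumMap_apply,
    Units.val_mul, coe_lowerGL]
  fin_cases s
  · simp [datumFun]
  · simp [datumFun, map_sum, Finset.sum_smul, smul_smul, ← hs, -map_pow]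
  · simp [datumFun]
  · simp [datumFun]

omit hr hp in
theorem sum_upperWeylGL_datumMap (τ : 𝔽 → O) (ι : 𝔽 →+* k) (S T : M →ₗ[k] M) (m : M) :
    ∑ t, rightTranslation k _ _ (upperWeylGL (τ t)) (datumMap p r τ ι S T (0, Pi.single 1 m)) =
      datumMap p r τ ι S T (Pi.single 3 m, 0) := by
  funext κ s
  simp only [Finset.sum_apply, rightTranslation_apply, datumMap_apply,
    Units.val_mul, coe_upperWeylGL]
  fin_cases s
  · simp [datumFun, ← sum_zFun, map_sum, Finset.sum_smul]
  · simp [datumFun]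
  · simp [datumFun]
  · simp [datumFun]

theorem sum_upperWeylGL_datumMap_pow (τ : 𝔽 → O) (ι : 𝔽 →+* k) (S T : M →ₗ[k] M) (m : M) :
    ∑ t, rightTranslation k _ _ (upperWeylGL (τ t)) (datumMap p r τ ι S T (0, Pi.single 2 m)) =
      datumMap p r τ ι S T (Pi.single 4 m, 0) := by
  have := hr.charP
  funext κ s
  simp only [Finset.sum_apply, rightTranslation_apply, datumMap_apply,
    Units.val_mul, coe_upperWeylGL]
  fin_cases s
  · simp [datumFun, ← sum_zFun, sum_pow_char, map_sum, Finset.sum_smul, -map_pow]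
  · simp [datumFun]
  · simp [datumFun]
  · simp [datumFun]

theorem sum_upperWeylGL_smul_datumMap (hodd : Odd p) (τ : 𝔽 → O) (hτ : ∀ t, r (τ t) = t)
    (ι : 𝔽 →+* k) (S T : M →ₗ[k] M) (m : M) :
    ∑ t, ι (- t) • rightTranslation k _ _ (upperWeylGL (τ t))
      (datumMap p r τ ι S T (0, Pi.single 3 m)) =
      datumMap p r τ ι S T (0, Pi.single 0 (S m)) := by
  funext κ s
  simp only [Finset.sum_apply, Pi.smul_apply, rightTranslation_apply, datumMap_apply,
    Units.val_mul, coe_upperWeylGL]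
  fin_cases s
  · simp only [datumFun, ← hr.sum_gFun hodd τ hτ]
    simp [map_sum, Finset.sum_smul, smul_smul]
  · simp [datumFun]
  · have h := congrArg (fun x => ι x • m) (hr.sum_eFun τ hτ κ)
    simp only [map_sum, map_mul, Finset.sum_smul] at h
    simpa [datumFun, smul_smul] using h
  · simp [datumFun]

theorem sum_upperWeylGL_smul_datumMap_pow (hodd : Odd p) (τ : 𝔽 → O) (hτ : ∀ t, r (τ t) = t)
    (ι : 𝔽 →+* k) (S T : M →ₗ[k] M) (m : M) :
    ∑ t, ι ((- t) ^ p) • rightTranslation k _ _ (upperWeylGL (τ t))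
      (datumMap p r τ ι S T (0, Pi.single 4 m)) =
      datumMap p r τ ι S T (0, Pi.single 0 (T m)) := by
  have := hr.charP
  have hs (κ : Matrix (Fin 2) (Fin 2) O) : ∑ t, (- t) ^ p *
      gFun p r (κ * !![τ t, -1; 1, 0]) ^ p = uFun p r κ := by
    rw [← hr.uFun_pow, ← hr.sum_gFun hodd τ hτ, sum_pow_char]
    exact Finset.sum_congr rfl fun t _ => (mul_pow _ _ _).symm
  have hs' (κ : Matrix (Fin 2) (Fin 2) O) : ∑ t, (- t) ^ p *
      eFun p r (κ * !![τ t, -1; 1, 0]) ^ p = 0 := by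
    have h0 := congrArg (fun x => x ^ p) (hr.sum_eFun τ hτ κ)
    simp only [zero_pow hp.out.ne_zero, sum_pow_char] at h0
    rw [← h0]
    exact Finset.sum_congr rfl fun t _ => (mul_pow _ _ _).symm
  funext κ s
  simp only [Finset.sum_apply, Pi.smul_apply, rightTranslation_apply, datumMap_apply,
    Units.val_mul, coe_upperWeylGL]
  fin_cases s
  · simp only [datumFun, ← hs]
    simp [map_sum, Finset.sum_smul, smul_smul]
  · simp [datumFun]
  · simp [datumFun]
  · have h := congrArg (fun x => ι x • m) (hs' κ)
    simp only [map_sum, map_mul, Finset.sum_smul] at h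
    simpa [datumFun, smul_smul] using h

theorem eq_zero_of_pow_smul_add_smul (ι : 𝔽 →+* k) (x y : M)
    (h : ∀ β : 𝔽, β ≠ 0 → ι (β ^ p) • x + ι β • y = 0) : x = 0 ∧ y = 0 := by
  have hp1 := hp.out.one_lt
  obtain ⟨β, hβ⟩ : ∃ β : 𝔽, β ^ p ≠ β := by
    by_contra! hcon
    have := FiniteField.X_pow_card_sub_X_natDegree_eq 𝔽 hp1
    have hne := FiniteField.X_pow_card_sub_X_ne_zero 𝔽 hp1
    have hle := Polynomial.card_le_degree_of_subset_roots
      (p := (Polynomial.X ^ p - Polynomial.X : Polynomial 𝔽)) (Z := Finset.univ) (by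
        intro t _
        rw [Polynomial.mem_roots hne]
        simp [hcon])
    rw [this, Finset.card_univ, hr.card_eq] at hle
    nlinarith
  have hβ0 : β ≠ 0 := by
    rintro rfl
    exact hβ (zero_pow hp.out.ne_zero)
  have h1 := h 1 one_ne_zero
  rw [one_pow, map_one, one_smul, one_smul] at h1
  have h2 := h β hβ0
  have h3 : y = -x := by rw [eq_neg_iff_add_eq_zero, add_comm, h1]
  rw [h3, smul_neg, ← sub_eq_add_neg, ← sub_smul, ← map_sub] at h2
  have h4 : ι (β ^ p - β) ≠ 0 := by
    rw [Ne, map_eq_zero, sub_eq_zero]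
    exact hβ
  have h5 := (smul_eq_zero.mp h2).resolve_left h4
  exact ⟨h5, by rw [h3, h5, neg_zero]⟩

theorem datumMap_injective (hodd : Odd p) (τ : 𝔽 → O)
    (hτ : ∀ t, r (τ t) = t ∧ theta p r (τ t) = 0) (ι : 𝔽 →+* k) (S T : M →ₗ[k] M) :
    Function.Injective (datumMap p r τ ι S T) := by
  rw [← LinearMap.ker_eq_bot, LinearMap.ker_eq_bot']
  rintro ⟨x, y⟩ h
  have h' (κ : Matrix (Fin 2) (Fin 2) O) (hκ : IsUnit κ.det) :
      datumFun p r τ ι S T (x, y) κ = 0 := by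
    have := congrFun h (Matrix.GeneralLinearGroup.mk'' κ hκ)
    exact this
  have hone := h' 1 (by simp)
  have hy3 : y 3 = 0 := by
    have := congrFun hone 2
    simpa [datumFun, eFun] using this
  have hy4 : y 4 = 0 := by
    have := congrFun hone 3
    simpa [datumFun, eFun] using this
  have hx0 : x 0 = 0 := by
    have := congrFun hone 1
    simpa [datumFun, vFun, wFun, hp.out.ne_zero] using this
  obtain ⟨hx1, hx2⟩ : x 1 = 0 ∧ x 2 = 0 := by
    refine hr.eq_zero_of_pow_smul_add_smul ι _ _ fun β _ => ?_
    have := congrFun (h' !![1, τ β; 0, 1] (by simp [Matrix.det_fin_two_of])) 1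
    simpa [datumFun, vFun, wFun, hx0, hτ, ← map_pow, hr.pow_p_pow_p] using this
  have hlow (γ : O) : ι (r γ ^ p) • y 1 + ι (r γ) • y 2 + y 0 = 0 := by
    have := congrFun (h' !![1, 0; p * γ, 1] (by simp [Matrix.det_fin_two_of])) 0
    have hu : uFun p r !![1, 0; p * γ, 1] = 1 := by simp [uFun, Matrix.det_fin_two_of]
    simp only [datumFun, hr.fFun_lower τ hτ, hr.zFun_lower, hu, hy3, hy4, hr.pow_p_pow_p] at this
    simp [hp.out.ne_zero] at this
    rw [← this, map_pow]
    abel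
  have hy0 : y 0 = 0 := by
    have := hlow 0
    simpa [hp.out.ne_zero] using this
  obtain ⟨hy1, hy2⟩ : y 1 = 0 ∧ y 2 = 0 := by
    refine hr.eq_zero_of_pow_smul_add_smul ι _ _ fun γ _ => ?_
    have := hlow (τ γ)
    rwa [hy0, add_zero, (hτ γ).1] at this
  obtain ⟨hx4, hx3⟩ : x 4 = 0 ∧ x 3 = 0 := by
    refine hr.eq_zero_of_pow_smul_add_smul ι _ _ fun α hα => ?_
    have hf := hr.fFun_iwahori τ hτ !![1, 0; 1, 1] (τ α) 0 0 1 (by rwa [(hτ α).1]) (by simp)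
    rw [hr.fFun_lower_one hodd τ hτ, (hτ α).1, map_one, one_pow, mul_one, mul_one] at hf
    have := congrFun (h' (!![1, 0; 1, 1] * !![τ α, 0; p * 0, 1]) (by
      rw [Matrix.det_mul, Matrix.det_fin_two_of, Matrix.det_fin_two_of]
      simpa using hr.isUnit_of_map_ne_zero (τ α) (by rwa [(hτ α).1]))) 0
    simp only [datumFun, hf, hy0, hy1, hy2, hy3, hy4] at this
    simp at this
    rw [← this, map_pow]
    abel
  refine Prod.ext (funext fun s => ?_) (funext fun s => ?_)
  · fin_cases s <;> simp [hx0, hx1, hx2, hx3, hx4]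
  · fin_cases s <;> simp [hy0, hy1, hy2, hy3, hy4]

end IsQuadraticReduction

end Datum

section Assembly

variable {p : ℕ} {𝔽 k M : Type*} [Field 𝔽] [Field k]
  [AddCommGroup M] [Module k M]

theorem iwahoriAct_zero (p : ℕ) (ι : 𝔽 →+* k) (α β δ : 𝔽) :
    iwahoriAct p ι α β δ (0 : Fin 5 → M) = 0 := by
  funext s
  fin_cases s <;> simp [iwahoriAct]

theorem iwahoriAct_one_single_zero (p : ℕ) (ι : 𝔽 →+* k) (m : M) :
    iwahoriAct p ι 1 0 1 (Pi.single 0 m : Fin 5 → M) = Pi.single 0 m := by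
  funext s
  fin_cases s <;> simp [iwahoriAct]

/-- An element of the group algebra which transforms `x` into `x'` under `R` does so by a
combination of elements of the image of `j`. -/
theorem asAlgebraHom_sum_smul_of {ν G K D₀ N : Type*} [Fintype ν] [Group G] [Group K]
    [AddCommGroup D₀] [Module k D₀] [AddCommGroup N] [Module k N] (ρ : Representation k K D₀)
    (R : Representation k G N) (Φ : D₀ →ₗ[k] N) (j : K → G)
    (h : ∀ κ x, R (j κ) (Φ x) = Φ (ρ κ x)) (c : ν → k) (f : ν → K) (x : D₀) :
    R.asAlgebraHom (∑ t, c t • MonoidAlgebra.of k G (j (f t))) (Φ x) =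
      Φ (∑ t, c t • ρ (f t) x) := by
  simp only [map_sum, map_smul, LinearMap.sum_apply, LinearMap.smul_apply,
    Representation.asAlgebraHom_of, h]

theorem IsQuadraticReduction.exists_irreducible {O 𝔽 k G : Type} [CommRing O] [Field 𝔽]
    [Fintype 𝔽] [Field k] [Group G] [TopologicalSpace G] [IsTopologicalGroup G] {r : O →+* 𝔽}
    (hr : IsQuadraticReduction p r) [hp : Fact p.Prime] (hodd : Odd p) (ι : 𝔽 →+* k)
    (j : GL (Fin 2) O × Multiplicative ℤ →* G) (hj : Function.Injective j) (ϖ : G)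
    (c : Multiplicative ℤ) (hϖ : ϖ * ϖ = j (1, c))
    (hconj : ∀ κ κ', j κ * ϖ = ϖ * j κ' → ∃ α β γ δ : O,
      (κ.1 : Matrix (Fin 2) (Fin 2) O) = !![δ, γ; p * β, α] ∧
      (κ'.1 : Matrix (Fin 2) (Fin 2) O) = !![α, β; p * γ, δ])
    (d : G → ℕ) (hd1 : d 1 = 0) (hdK : ∀ g κ, d (g * j κ) = d g)
    (hd0 : ∀ g, d g = 0 → ∃ κ, g = j κ)
    (hdlt : ∀ g, d g ≠ 0 → ∃ κ, d (g * j κ * ϖ) < d g)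
    (huniq : ∀ g κ κ', d (g * j κ * ϖ) < d g → d (g * j κ' * ϖ) < d g →
      ∃ κ'', j κ'' * ϖ = ϖ * j (κ⁻¹ * κ'))
    (hne : ∀ g, d (g * ϖ) ≠ d g) (H : Subgroup G) (hH : IsOpen (H : Set G))
    (hHj : ∀ h ∈ H, ∃ (κ : GL (Fin 2) O) (α β γ δ : O), h = j (κ, 1) ∧
      (κ : Matrix (Fin 2) (Fin 2) O) = !![α, β; p * γ, δ] ∧ r α = 1 ∧ r β = 0 ∧ r δ = 1) :
    ∃ (V : Type) (_ : AddCommGroup V) (_ : Module k V) (ρ : Representation k G V),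
      (∀ v : V, IsOpen {g : G | ρ g v = v}) ∧ Nontrivial V ∧
      (∀ W : Submodule k V, (∀ g : G, ∀ v ∈ W, ρ g v ∈ W) → W = ⊥ ∨ W = ⊤) ∧
      ¬ FiniteDimensional k (Representation.invariants (ρ.comp H.subtype)) := by
  obtain ⟨τ, hτ⟩ := hr.exists_lift
  let S : (ℕ → k) →ₗ[k] (ℕ → k) :=
    { toFun := fun f n => Nat.casesOn n 0 f
      map_add' := fun f g => by funext n; cases n <;> simp
      map_smul' := fun a f => by funext n; cases n <;> simp }
  let T : (ℕ → k) →ₗ[k] (ℕ → k) := LinearMap.funLeft k k Nat.succ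
  have hTS (f : ℕ → k) : T (S f) = f := rfl
  let e : ℕ → k := Pi.single 0 1
  have hTe : T e = 0 := by
    funext n
    simp [T, e, LinearMap.funLeft_apply]
  let i := datumMap p r τ ι S T
  have hi : Function.Injective i := hr.datumMap_injective hodd τ hτ ι S T
  let ρ : Representation k (GL (Fin 2) O × Multiplicative ℤ) (GL (Fin 2) O → Fin 4 → ℕ → k) :=
    (rightTranslation k (GL (Fin 2) O) (Fin 4 → ℕ → k)).comp (MonoidHom.fst _ _)
  have hρ (κ : GL (Fin 2) O) (n : Multiplicative ℤ) :
      ρ (κ, n) = rightTranslation k (GL (Fin 2) O) (Fin 4 → ℕ → k) κ := rfl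
  let P : ((Fin 5 → ℕ → k) × (Fin 5 → ℕ → k)) →ₗ[k] ((Fin 5 → ℕ → k) × (Fin 5 → ℕ → k)) :=
    (LinearMap.snd k _ _).prod (LinearMap.fst k _ _)
  obtain ⟨R, Φ, hΦ, hRK, hRϖ⟩ := exists_amalgam_embedding ρ j hj ϖ (1, c) hϖ i hi P
    (fun x => rfl) (fun x => by rw [hρ, map_one]; rfl)
    (by
      rintro ⟨κ, n⟩ ⟨κ', n'⟩ h ⟨x, y⟩
      obtain ⟨α, β, γ, δ, h1, h2⟩ := hconj _ _ h
      refine ⟨(iwahoriAct p ι (r α) (r β) (r δ) x, iwahoriAct p ι (r δ) (r γ) (r α) y), ?_, ?_⟩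
      · rw [hρ]
        exact hr.rightTranslation_datumMap τ hτ ι S T _ α β γ δ h2 x y
      · rw [hρ]
        exact hr.rightTranslation_datumMap τ hτ ι S T _ δ γ β α h1 y x)
    d hd1 hdK hd0 hdlt huniq hne
  let Ψ (m : ℕ → k) : G → GL (Fin 2) O → Fin 4 → ℕ → k := Φ (i (Pi.single 0 m, 0))
  have hsum (a : 𝔽 → k) (f : 𝔽 → GL (Fin 2) O) (x : GL (Fin 2) O → Fin 4 → ℕ → k) :
      R.asAlgebraHom (∑ t, a t • MonoidAlgebra.of k G (j (f t, 1))) (Φ x) =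
        Φ (∑ t, a t • rightTranslation k _ _ (f t) x) :=
    asAlgebraHom_sum_smul_of ρ R Φ j hRK a (fun t => (f t, 1)) x
  let w := MonoidAlgebra.of k G ϖ
  have hw (x) : R.asAlgebraHom w (Φ (i x)) = Φ (i (P x)) := by
    rw [Representation.asAlgebraHom_of, hRϖ]
  let L (a : 𝔽 → k) (f : 𝔽 → GL (Fin 2) O) : MonoidAlgebra k G :=
    ∑ t, a t • MonoidAlgebra.of k G (j (f t, 1))
  let rr := w * L (fun t => ι (-t)) (fun t => upperWeylGL (τ t)) * w *
    L (fun _ => 1) (fun t => upperWeylGL (τ t)) * w *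
    L (fun t => ι (-t ^ (p ^ 2 - 1 - p))) (fun t => lowerGL (τ t))
  let ll := w * L (fun t => ι ((-t) ^ p)) (fun t => upperWeylGL (τ t)) * w *
    L (fun _ => 1) (fun t => upperWeylGL (τ t)) * w *
    L (fun t => ι ((-t ^ (p ^ 2 - 1 - p)) ^ p)) (fun t => lowerGL (τ t))
  have hrr (m : ℕ → k) : R.asAlgebraHom rr (Ψ m) = Ψ (S m) := by
    simp only [rr, Ψ, map_mul, Module.End.mul_apply]
    rw [hsum, hr.sum_lowerGL_datumMap τ (fun t => (hτ t).1), hw, hsum]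
    simp only [one_smul]
    rw [show P (Pi.single 1 m, 0) = (0, Pi.single 1 m) from rfl,
      IsQuadraticReduction.sum_upperWeylGL_datumMap,
      hw, hsum, show P (Pi.single 3 m, 0) = (0, Pi.single 3 m) from rfl,
      hr.sum_upperWeylGL_smul_datumMap hodd τ (fun t => (hτ t).1), hw]
    rfl
  have hll (m : ℕ → k) : R.asAlgebraHom ll (Ψ m) = Ψ (T m) := by
    simp only [ll, Ψ, map_mul, Module.End.mul_apply]
    rw [hsum, hr.sum_lowerGL_datumMap_pow τ (fun t => (hτ t).1), hw, hsum]
    simp only [one_smul]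
    rw [show P (Pi.single 2 m, 0) = (0, Pi.single 2 m) from rfl, hr.sum_upperWeylGL_datumMap_pow,
      hw, hsum, show P (Pi.single 4 m, 0) = (0, Pi.single 4 m) from rfl,
      hr.sum_upperWeylGL_smul_datumMap_pow hodd τ (fun t => (hτ t).1), hw]
    rfl
  have hpow (n : ℕ) : R.asAlgebraHom (rr ^ n) (Ψ e) = Ψ ((S ^ n) e) := by
    induction n with
    | zero => simp
    | succ n ih =>
      rw [pow_succ', map_mul, Module.End.mul_apply, ih, hrr, pow_succ', Module.End.mul_apply]
  refine exists_irreducible_of_shift R H hH (Ψ e) ?_ rr ll ?_ ?_ ?_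
  · intro h
    have h1 := hi (hΦ (h.trans (by simp : (0 : _) = Φ (i 0))))
    have h2 := congrFun (congrFun (congrArg Prod.fst h1) 0) 0
    simp [e] at h2
  · intro n h hh
    obtain ⟨κ, α, β, γ, δ, rfl, hκ, hα, hβ, hδ⟩ := hHj h hh
    rw [hpow, hRK, hρ, hr.rightTranslation_datumMap τ hτ ι S T _ α β γ δ hκ, hα, hβ, hδ,
      iwahoriAct_zero, iwahoriAct_one_single_zero]
  · intro n
    rw [map_mul, Module.End.mul_apply, hpow, hpow, hll, pow_succ', Module.End.mul_apply, hTS]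
  · rw [hll, hTe]
    simp only [Ψ, Pi.single_zero, Prod.mk_zero_zero, map_zero]

end Assembly

section UnitBall

/-- The closed unit ball of an ultrametric normed field. -/
def unitBall (F : Type*) [NormedField F] [IsUltrametricDist F] : Subring F where
  carrier := {x | ‖x‖ ≤ 1}
  mul_mem' {a b} ha hb := by
    rw [Set.mem_ofPred_eq, norm_mul]
    exact mul_le_one₀ ha (norm_nonneg _) hb
  one_mem' := by simp
  add_mem' {a b} ha hb :=
    (IsUltrametricDist.norm_add_le_max a b).trans (max_le ha hb)
  zero_mem' := by simp
  neg_mem' {a} ha := by simpa using ha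

variable {F : Type*} [NormedField F]

/-- The larger norm of the two entries of a column. -/
noncomputable def colNorm (g : Matrix (Fin 2) (Fin 2) F) (s : Fin 2) : ℝ := max ‖g 0 s‖ ‖g 1 s‖

/-- The largest norm of the entries of a matrix. -/
noncomputable def entryNorm (g : Matrix (Fin 2) (Fin 2) F) : ℝ := max (colNorm g 0) (colNorm g 1)

theorem norm_le_colNorm (g : Matrix (Fin 2) (Fin 2) F) (i s : Fin 2) : ‖g i s‖ ≤ colNorm g s := by
  fin_cases i
  · exact le_max_left _ _
  · exact le_max_right _ _

theorem colNorm_le_entryNorm (g : Matrix (Fin 2) (Fin 2) F) (s : Fin 2) :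
    colNorm g s ≤ entryNorm g := by
  fin_cases s
  · exact le_max_left _ _
  · exact le_max_right _ _

theorem norm_le_entryNorm (g : Matrix (Fin 2) (Fin 2) F) (i s : Fin 2) : ‖g i s‖ ≤ entryNorm g :=
  (norm_le_colNorm g i s).trans (colNorm_le_entryNorm g s)

theorem exists_norm_eq_colNorm (g : Matrix (Fin 2) (Fin 2) F) (s : Fin 2) :
    ∃ i, ‖g i s‖ = colNorm g s := by
  rcases max_choice ‖g 0 s‖ ‖g 1 s‖ with h | h
  · exact ⟨0, h.symm⟩
  · exact ⟨1, h.symm⟩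

theorem exists_colNorm_eq_entryNorm (g : Matrix (Fin 2) (Fin 2) F) :
    ∃ s, colNorm g s = entryNorm g := by
  rcases max_choice (colNorm g 0) (colNorm g 1) with h | h
  · exact ⟨0, h.symm⟩
  · exact ⟨1, h.symm⟩

theorem colNorm_le {g : Matrix (Fin 2) (Fin 2) F} {s : Fin 2} {c : ℝ} (h : ∀ i, ‖g i s‖ ≤ c) :
    colNorm g s ≤ c := max_le (h 0) (h 1)

theorem entryNorm_le {g : Matrix (Fin 2) (Fin 2) F} {c : ℝ} (h : ∀ i s, ‖g i s‖ ≤ c) :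
    entryNorm g ≤ c := max_le (colNorm_le fun i => h i 0) (colNorm_le fun i => h i 1)

theorem colNorm_smul (c : F) (g : Matrix (Fin 2) (Fin 2) F) (s : Fin 2) :
    colNorm (c • g) s = ‖c‖ * colNorm g s := by
  simp [colNorm, mul_max_of_nonneg]

theorem entryNorm_smul (c : F) (g : Matrix (Fin 2) (Fin 2) F) :
    entryNorm (c • g) = ‖c‖ * entryNorm g := by
  simp [entryNorm, colNorm_smul, mul_max_of_nonneg]

theorem entryNorm_one : entryNorm (1 : Matrix (Fin 2) (Fin 2) F) = 1 := by
  simp [entryNorm, colNorm]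

theorem norm_det_pos (g : GL (Fin 2) F) : 0 < ‖(g : Matrix (Fin 2) (Fin 2) F).det‖ :=
  norm_pos_iff.mpr ((Matrix.isUnit_iff_isUnit_det _).mp g.isUnit).ne_zero

variable [IsUltrametricDist F]

theorem entryNorm_mul_le (g h : Matrix (Fin 2) (Fin 2) F) (hh : ∀ i s, ‖h i s‖ ≤ 1) :
    entryNorm (g * h) ≤ entryNorm g := by
  refine entryNorm_le fun i s => ?_
  have h1 (t : Fin 2) : ‖g i t * h t s‖ ≤ entryNorm g := by
    rw [norm_mul]
    exact (mul_le_of_le_one_right (norm_nonneg _) (hh t s)).trans (norm_le_entryNorm g i t)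
  rw [Matrix.mul_apply, Fin.sum_univ_two]
  exact (IsUltrametricDist.norm_add_le_max _ _).trans (max_le (h1 0) (h1 1))

theorem norm_det_le (g : Matrix (Fin 2) (Fin 2) F) : ‖g.det‖ ≤ entryNorm g ^ 2 := by
  have h1 (i s t u : Fin 2) : ‖g i s * g t u‖ ≤ entryNorm g ^ 2 := by
    rw [norm_mul, sq]
    exact mul_le_mul (norm_le_entryNorm g i s) (norm_le_entryNorm g t u) (norm_nonneg _)
      ((norm_nonneg _).trans (norm_le_entryNorm g i s))
  rw [Matrix.det_fin_two, sub_eq_add_neg]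
  refine (IsUltrametricDist.norm_add_le_max _ _).trans (max_le (h1 _ _ _ _) ?_)
  rw [norm_neg]
  exact h1 _ _ _ _

theorem mem_unitBall {x : F} : x ∈ unitBall F ↔ ‖x‖ ≤ 1 := Iff.rfl

theorem unitBall_norm_le (x : unitBall F) : ‖(x : F)‖ ≤ 1 := x.2

theorem norm_coe_eq_one_of_isUnit {x : unitBall F} (hx : IsUnit x) : ‖(x : F)‖ = 1 := by
  obtain ⟨y, hy⟩ := hx.exists_right_inv
  have h : ‖(x : F)‖ * ‖(y : F)‖ = 1 := by
    rw [← norm_mul, ← Subring.coe_mul, hy, Subring.coe_one, norm_one]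
  nlinarith [unitBall_norm_le x, unitBall_norm_le y, norm_nonneg (x : F), norm_nonneg (y : F)]

theorem isUnit_of_norm_coe_eq_one {x : unitBall F} (hx : ‖(x : F)‖ = 1) : IsUnit x := by
  have h0 : (x : F) ≠ 0 := by
    rw [← norm_ne_zero_iff, hx]
    exact one_ne_zero
  exact IsUnit.of_mul_eq_one ⟨(x : F)⁻¹, by rw [mem_unitBall, norm_inv, hx, inv_one]⟩
    (Subtype.ext (mul_inv_cancel₀ h0))

/-- The inclusion of the integral invertible matrices. -/
noncomputable def integralGL (F : Type*) [NormedField F] [IsUltrametricDist F] :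
    GL (Fin 2) (unitBall F) →* GL (Fin 2) F :=
  Matrix.GeneralLinearGroup.map (unitBall F).subtype

theorem coe_integralGL_apply (κ : GL (Fin 2) (unitBall F)) (i s : Fin 2) :
    (integralGL F κ : Matrix (Fin 2) (Fin 2) F) i s =
      ((κ : Matrix (Fin 2) (Fin 2) (unitBall F)) i s : F) := rfl

theorem det_integralGL (κ : GL (Fin 2) (unitBall F)) :
    (integralGL F κ : Matrix (Fin 2) (Fin 2) F).det =
      ((κ : Matrix (Fin 2) (Fin 2) (unitBall F)).det : F) := by
  rw [Matrix.det_fin_two, Matrix.det_fin_two]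
  simp [coe_integralGL_apply]

theorem norm_det_integralGL (κ : GL (Fin 2) (unitBall F)) :
    ‖(integralGL F κ : Matrix (Fin 2) (Fin 2) F).det‖ = 1 := by
  rw [det_integralGL]
  exact norm_coe_eq_one_of_isUnit ((Matrix.isUnit_iff_isUnit_det _).mp κ.isUnit)

theorem integralGL_injective : Function.Injective (integralGL F) := by
  intro κ κ' h
  refine Units.ext (Matrix.ext fun i s => Subtype.ext ?_)
  rw [← coe_integralGL_apply, h, coe_integralGL_apply]

theorem exists_integralGL_eq (g : GL (Fin 2) F)
    (h : ∀ i s, ‖(g : Matrix (Fin 2) (Fin 2) F) i s‖ ≤ 1)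
    (hdet : ‖(g : Matrix (Fin 2) (Fin 2) F).det‖ = 1) : ∃ κ, g = integralGL F κ := by
  let A : Matrix (Fin 2) (Fin 2) (unitBall F) := Matrix.of fun i s => ⟨_, h i s⟩
  have hA : (A.det : F) = (g : Matrix (Fin 2) (Fin 2) F).det := by
    rw [Matrix.det_fin_two, Matrix.det_fin_two]
    simp [A]
  exact ⟨Matrix.GeneralLinearGroup.mk'' A (isUnit_of_norm_coe_eq_one (by rw [hA, hdet])), by
    ext i s; rfl⟩

theorem entryNorm_mul_integralGL (g : Matrix (Fin 2) (Fin 2) F) (κ : GL (Fin 2) (unitBall F)) :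
    entryNorm (g * (integralGL F κ : Matrix (Fin 2) (Fin 2) F)) = entryNorm g := by
  refine le_antisymm (entryNorm_mul_le _ _ fun i s => unitBall_norm_le _) ?_
  have h : g = g * (integralGL F κ : Matrix (Fin 2) (Fin 2) F) *
      (integralGL F κ⁻¹ : Matrix (Fin 2) (Fin 2) F) := by
    rw [mul_assoc, ← Units.val_mul, ← map_mul, mul_inv_cancel, map_one, Units.val_one, mul_one]
  conv_lhs => rw [h]
  exact entryNorm_mul_le _ _ fun i s => unitBall_norm_le _

theorem entryNorm_pos (g : GL (Fin 2) F) : 0 < entryNorm (g : Matrix (Fin 2) (Fin 2) F) := by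
  by_contra! hcon
  have h1 := norm_det_le (g : Matrix (Fin 2) (Fin 2) F)
  have h2 : 0 ≤ entryNorm (g : Matrix (Fin 2) (Fin 2) F) :=
    (norm_nonneg ((g : Matrix (Fin 2) (Fin 2) F) 0 0)).trans (norm_le_entryNorm _ 0 0)
  rw [le_antisymm hcon h2, zero_pow two_ne_zero, norm_le_zero_iff] at h1
  exact ((Matrix.isUnit_iff_isUnit_det _).mp g.isUnit).ne_zero h1

end UnitBall

section Tree

/-- The norm of `F` has value group generated by the norm of `p`, normalized to `p⁻¹`. -/
structure IsUnramifiedNorm (p : ℕ) (F : Type*) [NormedField F] : Prop where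
  norm_p : ‖(p : F)‖ = (p : ℝ)⁻¹
  exists_zpow : ∀ x : F, x ≠ 0 → ∃ n : ℤ, ‖x‖ = (p : ℝ) ^ n

/-- The matrix `!![0, 1; π, 0]`. -/
noncomputable def atkinLehner {F : Type*} [Field F] (π : Fˣ) : GL (Fin 2) F :=
  Matrix.GeneralLinearGroup.mk'' !![0, 1; (π : F), 0] (by simp [Matrix.det_fin_two_of])

theorem coe_atkinLehner {F : Type*} [Field F] (π : Fˣ) :
    (atkinLehner π : Matrix (Fin 2) (Fin 2) F) = !![0, 1; (π : F), 0] := rfl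

variable {p : ℕ} {F : Type*} [NormedField F]

theorem colNorm_mul_atkinLehner_zero (g : Matrix (Fin 2) (Fin 2) F) (π : Fˣ) :
    colNorm (g * (atkinLehner π : Matrix (Fin 2) (Fin 2) F)) 0 = ‖(π : F)‖ * colNorm g 1 := by
  simp [colNorm, coe_atkinLehner, Matrix.mul_apply, mul_max_of_nonneg, mul_comm]

theorem colNorm_mul_atkinLehner_one (g : Matrix (Fin 2) (Fin 2) F) (π : Fˣ) :
    colNorm (g * (atkinLehner π : Matrix (Fin 2) (Fin 2) F)) 1 = colNorm g 0 := by
  simp [colNorm, coe_atkinLehner, Matrix.mul_apply]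

theorem norm_det_mul_atkinLehner (g : Matrix (Fin 2) (Fin 2) F) (π : Fˣ) :
    ‖(g * (atkinLehner π : Matrix (Fin 2) (Fin 2) F)).det‖ = ‖(π : F)‖ * ‖g.det‖ := by
  rw [Matrix.det_mul, coe_atkinLehner, Matrix.det_fin_two_of, norm_mul, mul_comm]
  simp

/-- The distance from the base vertex to its translate by `g` in the tree of `GL₂`. -/
noncomputable def treeDist (p : ℕ) (g : GL (Fin 2) F) : ℕ :=
  sInf {n : ℕ | entryNorm (g : Matrix (Fin 2) (Fin 2) F) ^ 2 =
    (p : ℝ) ^ n * ‖(g : Matrix (Fin 2) (Fin 2) F).det‖}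

namespace IsUnramifiedNorm

variable (hF : IsUnramifiedNorm p F) [hp : Fact p.Prime]

theorem treeDist_eq {g : GL (Fin 2) F} {n : ℕ}
    (h : entryNorm (g : Matrix (Fin 2) (Fin 2) F) ^ 2 =
      (p : ℝ) ^ n * ‖(g : Matrix (Fin 2) (Fin 2) F).det‖) : treeDist p g = n := by
  have h1 := Nat.sInf_mem (s := {n : ℕ | entryNorm (g : Matrix (Fin 2) (Fin 2) F) ^ 2 =
    (p : ℝ) ^ n * ‖(g : Matrix (Fin 2) (Fin 2) F).det‖}) ⟨n, h⟩
  rw [Set.mem_ofPred_eq] at h1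
  nth_rw 1 [h] at h1
  have h2 := mul_right_cancel₀ (norm_det_pos g).ne' h1
  have hp1 : (1 : ℝ) < p := by exact_mod_cast hp.out.one_lt
  exact (pow_right_injective₀ (zero_lt_one.trans hp1) hp1.ne' h2).symm

include hF

theorem le_inv_mul_of_lt {x y : F} (h : ‖x‖ < ‖y‖) : ‖x‖ ≤ (p : ℝ)⁻¹ * ‖y‖ := by
  have hp1 : (1 : ℝ) < p := by exact_mod_cast hp.out.one_lt
  by_cases hx : x = 0
  · rw [hx, norm_zero]
    positivity
  have hy : y ≠ 0 := norm_pos_iff.mp ((norm_nonneg x).trans_lt h)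
  obtain ⟨a, ha⟩ := hF.exists_zpow x hx
  obtain ⟨b, hb⟩ := hF.exists_zpow y hy
  rw [ha, hb] at h ⊢
  rw [← _root_.zpow_neg_one, ← zpow_add₀ (zero_lt_one.trans hp1).ne']
  have := (zpow_lt_zpow_iff_right₀ hp1).mp h
  exact zpow_le_zpow_right₀ hp1.le (by omega)

theorem treeDist_mul_atkinLehner_of_le {π : Fˣ} (hπ : (π : F) = p) [IsUltrametricDist F]
    {g : GL (Fin 2) F} {n : ℕ}
    (h : entryNorm (g : Matrix (Fin 2) (Fin 2) F) ^ 2 =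
      (p : ℝ) ^ n * ‖(g : Matrix (Fin 2) (Fin 2) F).det‖)
    (hle : colNorm (g : Matrix (Fin 2) (Fin 2) F) 1 ≤ colNorm (g : Matrix (Fin 2) (Fin 2) F) 0) :
    treeDist p (g * atkinLehner π) = n + 1 := by
  have hp1 : (1 : ℝ) < p := by exact_mod_cast hp.out.one_lt
  have hp0 := (zero_lt_one.trans hp1).ne'
  apply treeDist_eq
  rw [Units.val_mul, norm_det_mul_atkinLehner, entryNorm, colNorm_mul_atkinLehner_zero,
    colNorm_mul_atkinLehner_one, hπ, hF.norm_p, max_eq_right, ← max_eq_left hle]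
  · change entryNorm _ ^ 2 = _
    rw [h, pow_succ]
    field_simp
  · have h0 : 0 ≤ colNorm (g : Matrix (Fin 2) (Fin 2) F) 1 :=
      (norm_nonneg _).trans (norm_le_colNorm (g : Matrix (Fin 2) (Fin 2) F) 0 1)
    exact (mul_le_of_le_one_left h0 (inv_le_one_of_one_le₀ hp1.le)).trans hle

theorem treeDist_mul_atkinLehner_of_lt {π : Fˣ} (hπ : (π : F) = p) [IsUltrametricDist F]
    {g : GL (Fin 2) F} {n : ℕ}
    (h : entryNorm (g : Matrix (Fin 2) (Fin 2) F) ^ 2 =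
      (p : ℝ) ^ n * ‖(g : Matrix (Fin 2) (Fin 2) F).det‖)
    (hlt : colNorm (g : Matrix (Fin 2) (Fin 2) F) 0 < colNorm (g : Matrix (Fin 2) (Fin 2) F) 1) :
    treeDist p (g * atkinLehner π) + 1 = n := by
  have hp1 : (1 : ℝ) < p := by exact_mod_cast hp.out.one_lt
  have hp0 := (zero_lt_one.trans hp1).ne'
  have hle : colNorm (g : Matrix (Fin 2) (Fin 2) F) 0 ≤
      (p : ℝ)⁻¹ * colNorm (g : Matrix (Fin 2) (Fin 2) F) 1 := by
    obtain ⟨i, hi⟩ := exists_norm_eq_colNorm (g : Matrix (Fin 2) (Fin 2) F) 0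
    obtain ⟨i', hi'⟩ := exists_norm_eq_colNorm (g : Matrix (Fin 2) (Fin 2) F) 1
    rw [← hi, ← hi'] at hlt ⊢
    exact hF.le_inv_mul_of_lt hlt
  have hN : entryNorm ((g * atkinLehner π : GL (Fin 2) F) : Matrix (Fin 2) (Fin 2) F) =
      (p : ℝ)⁻¹ * entryNorm (g : Matrix (Fin 2) (Fin 2) F) := by
    rw [Units.val_mul, entryNorm, colNorm_mul_atkinLehner_zero,
      colNorm_mul_atkinLehner_one, hπ, hF.norm_p, max_eq_left hle, entryNorm, max_eq_right hlt.le]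
  have hdet := norm_det_mul_atkinLehner (g : Matrix (Fin 2) (Fin 2) F) π
  rw [hπ, hF.norm_p] at hdet
  have hdpos := norm_det_pos g
  rcases n with _ | n
  · have h1 := norm_det_le ((g * atkinLehner π : GL (Fin 2) F) : Matrix (Fin 2) (Fin 2) F)
    rw [hN, mul_pow, h, Units.val_mul, hdet, pow_zero, one_mul, sq, mul_assoc] at h1
    have h2 := le_of_mul_le_mul_left h1 (inv_pos.mpr (zero_lt_one.trans hp1))
    have h3 : (p : ℝ)⁻¹ * ‖(g : Matrix (Fin 2) (Fin 2) F).det‖ <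
        ‖(g : Matrix (Fin 2) (Fin 2) F).det‖ :=
      mul_lt_of_lt_one_left hdpos (inv_lt_one_of_one_lt₀ hp1)
    exact absurd h2 h3.not_ge
  · rw [add_left_inj]
    apply treeDist_eq
    rw [hN, Units.val_mul, hdet, mul_pow, h]
    field_simp
    ring

variable [IsUltrametricDist F]

theorem entryNorm_sq (g : GL (Fin 2) F) : entryNorm (g : Matrix (Fin 2) (Fin 2) F) ^ 2 =
      (p : ℝ) ^ treeDist p g * ‖(g : Matrix (Fin 2) (Fin 2) F).det‖ := by
  have hp1 : (1 : ℝ) < p := by exact_mod_cast hp.out.one_lt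
  have hp0 := (zero_lt_one.trans hp1).ne'
  obtain ⟨s, hs⟩ := exists_colNorm_eq_entryNorm (g : Matrix (Fin 2) (Fin 2) F)
  obtain ⟨i, hi⟩ := exists_norm_eq_colNorm (g : Matrix (Fin 2) (Fin 2) F) s
  have hpos := entryNorm_pos g
  obtain ⟨a, ha⟩ := hF.exists_zpow ((g : Matrix (Fin 2) (Fin 2) F) i s)
    (norm_pos_iff.mp (by rwa [hi, hs]))
  rw [hi, hs] at ha
  obtain ⟨b, hb⟩ := hF.exists_zpow _ (norm_pos_iff.mp (norm_det_pos g))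
  have hle := norm_det_le (g : Matrix (Fin 2) (Fin 2) F)
  rw [ha, hb, ← zpow_natCast, ← _root_.zpow_mul] at hle
  have hab := (zpow_le_zpow_iff_right₀ hp1).mp hle
  have h : entryNorm (g : Matrix (Fin 2) (Fin 2) F) ^ 2 = (p : ℝ) ^ ((a * (2 : ℕ) - b).toNat) *
      ‖(g : Matrix (Fin 2) (Fin 2) F).det‖ := by
    rw [ha, hb, ← zpow_natCast, ← zpow_natCast, ← _root_.zpow_mul, ← zpow_add₀ hp0]
    congr 1
    omega
  rw [treeDist_eq h, h]

theorem treeDist_mul_atkinLehner_ne {π : Fˣ} (hπ : (π : F) = p) (g : GL (Fin 2) F) :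
    treeDist p (g * atkinLehner π) ≠ treeDist p g := by
  rcases le_or_gt (colNorm (g : Matrix (Fin 2) (Fin 2) F) 1)
    (colNorm (g : Matrix (Fin 2) (Fin 2) F) 0) with h | h
  · rw [hF.treeDist_mul_atkinLehner_of_le hπ (hF.entryNorm_sq g) h]
    omega
  · have := hF.treeDist_mul_atkinLehner_of_lt hπ (hF.entryNorm_sq g) h
    omega

theorem treeDist_mul_atkinLehner_lt_iff {π : Fˣ} (hπ : (π : F) = p) (g : GL (Fin 2) F) :
    treeDist p (g * atkinLehner π) < treeDist p g ↔
      colNorm (g : Matrix (Fin 2) (Fin 2) F) 0 < colNorm (g : Matrix (Fin 2) (Fin 2) F) 1 := by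
  rcases le_or_gt (colNorm (g : Matrix (Fin 2) (Fin 2) F) 1)
    (colNorm (g : Matrix (Fin 2) (Fin 2) F) 0) with h | h
  · rw [hF.treeDist_mul_atkinLehner_of_le hπ (hF.entryNorm_sq g) h]
    exact ⟨fun h' => by omega, fun h' => absurd h h'.not_ge⟩
  · have := hF.treeDist_mul_atkinLehner_of_lt hπ (hF.entryNorm_sq g) h
    exact ⟨fun _ => h, fun _ => by omega⟩

theorem treeDist_mul_of_smul {g : GL (Fin 2) F} {κ : GL (Fin 2) (unitBall F)} {h : GL (Fin 2) F}
    {c : F} (hh : (h : Matrix (Fin 2) (Fin 2) F) =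
      c • (integralGL F κ : Matrix (Fin 2) (Fin 2) F)) :
    treeDist p (g * h) = treeDist p g := by
  apply treeDist_eq
  rw [Units.val_mul, hh, Matrix.mul_smul, entryNorm_smul, entryNorm_mul_integralGL,
    Matrix.det_smul, Matrix.det_mul, norm_mul, norm_mul, norm_det_integralGL, mul_pow,
    hF.entryNorm_sq g, Fintype.card_fin, norm_pow]
  ring

end IsUnramifiedNorm

end Tree

section Scaled

variable {p : ℕ} {F : Type*} [NormedField F] [IsUltrametricDist F]

/-- The product of an integral invertible matrix and a power of the scalar `π`. -/
noncomputable def scaledGL (π : Fˣ) :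
    GL (Fin 2) (unitBall F) × Multiplicative ℤ →* GL (Fin 2) F :=
  (integralGL F).noncommCoprod
    ((Units.map (Matrix.scalar (Fin 2) : F →+* Matrix (Fin 2) (Fin 2) F).toMonoidHom).comp
      (zpowersHom Fˣ π)) fun κ n => by
    refine Units.ext ?_
    exact (Matrix.scalar_commute _ (fun b => Commute.all _ b) _).symm

theorem coe_scaledGL (π : Fˣ) (κ : GL (Fin 2) (unitBall F) × Multiplicative ℤ) :
    (scaledGL π κ : Matrix (Fin 2) (Fin 2) F) =
      (π : F) ^ Multiplicative.toAdd κ.2 • (integralGL F κ.1 : Matrix (Fin 2) (Fin 2) F) := by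
  change (integralGL F κ.1 : Matrix (Fin 2) (Fin 2) F) *
    Matrix.scalar (Fin 2) ((zpowersHom Fˣ π κ.2 : Fˣ) : F) = _
  rw [Matrix.scalar_apply, zpowersHom_apply, Units.val_zpow_eq_zpow_val,
    ← Matrix.smul_one_eq_diagonal, Matrix.mul_smul, mul_one]

theorem scaledGL_one (π : Fˣ) (κ : GL (Fin 2) (unitBall F)) :
    scaledGL π (κ, 1) = integralGL F κ := by
  refine Units.ext ?_
  rw [coe_scaledGL]
  simp

theorem atkinLehner_mul_self (π : Fˣ) :
    atkinLehner π * atkinLehner π = scaledGL π (1, Multiplicative.ofAdd 1) := by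
  refine Units.ext ?_
  rw [coe_scaledGL, Units.val_mul, coe_atkinLehner]
  ext i s
  fin_cases i <;> fin_cases s <;> simp

namespace IsUnramifiedNorm

variable (hF : IsUnramifiedNorm p F) [hp : Fact p.Prime]
include hF

omit [IsUltrametricDist F] hp in
theorem norm_zpow_eq {π : Fˣ} (hπ : (π : F) = p) (n : ℤ) : ‖(π : F) ^ n‖ = ((p : ℝ)⁻¹) ^ n := by
  rw [norm_zpow, hπ, hF.norm_p]

omit [IsUltrametricDist F] in
theorem zpow_eq_of_norm_eq {π : Fˣ} (hπ : (π : F) = p) {m n : ℤ}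
    (h : ‖(π : F) ^ m‖ ^ 2 = ‖(π : F) ^ n‖ ^ 2) : m = n := by
  have hp1 : (1 : ℝ) < p := by exact_mod_cast hp.out.one_lt
  have h1 := (sq_eq_sq₀ (norm_nonneg _) (norm_nonneg _)).mp h
  rw [hF.norm_zpow_eq hπ, hF.norm_zpow_eq hπ] at h1
  exact zpow_right_injective₀ (inv_pos.mpr (zero_lt_one.trans hp1))
    (inv_lt_one_of_one_lt₀ hp1).ne h1

omit hF hp in
theorem norm_det_scaledGL (π : Fˣ) (κ : GL (Fin 2) (unitBall F) × Multiplicative ℤ) :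
    ‖(scaledGL π κ : Matrix (Fin 2) (Fin 2) F).det‖ =
      ‖(π : F) ^ Multiplicative.toAdd κ.2‖ ^ 2 := by
  rw [coe_scaledGL, Matrix.det_smul, norm_mul, norm_det_integralGL, mul_one, Fintype.card_fin,
    norm_pow]

theorem scaledGL_injective {π : Fˣ} (hπ : (π : F) = p) : Function.Injective (scaledGL π) := by
  rw [injective_iff_map_eq_one]
  rintro ⟨κ, n⟩ h
  have h1 := norm_det_scaledGL π (κ, n)
  have h2 : n = 1 := by
    have := hF.zpow_eq_of_norm_eq hπ (m := Multiplicative.toAdd n) (n := 0) (by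
      rw [← h1, h]; simp)
    exact Multiplicative.toAdd.injective this
  rw [h2, scaledGL_one] at h
  rw [h2, Prod.mk_eq_one]
  exact ⟨(injective_iff_map_eq_one _).mp integralGL_injective _ h, rfl⟩

theorem treeDist_mul_scaledGL (π : Fˣ) (g : GL (Fin 2) F)
    (κ : GL (Fin 2) (unitBall F) × Multiplicative ℤ) :
    treeDist p (g * scaledGL π κ) = treeDist p g :=
  hF.treeDist_mul_of_smul (coe_scaledGL π κ)

theorem exists_eq_scaledGL {π : Fˣ} (hπ : (π : F) = p) (g : GL (Fin 2) F)
    (h : treeDist p g = 0) : ∃ κ, g = scaledGL π κ := by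
  obtain ⟨s, hs⟩ := exists_colNorm_eq_entryNorm (g : Matrix (Fin 2) (Fin 2) F)
  obtain ⟨i, hi⟩ := exists_norm_eq_colNorm (g : Matrix (Fin 2) (Fin 2) F) s
  have hpos := entryNorm_pos g
  obtain ⟨a, ha⟩ := hF.exists_zpow ((g : Matrix (Fin 2) (Fin 2) F) i s)
    (norm_pos_iff.mp (by rwa [hi, hs]))
  rw [hi, hs] at ha
  have hc : ‖(π : F) ^ a‖ * entryNorm (g : Matrix (Fin 2) (Fin 2) F) = 1 := by
    rw [hF.norm_zpow_eq hπ, ha, _root_.inv_zpow, inv_mul_cancel₀ (ha ▸ hpos.ne')]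
  have hsq := hF.entryNorm_sq g
  rw [h, pow_zero, one_mul] at hsq
  let g' := g * scaledGL π (1, Multiplicative.ofAdd a)
  have hg' : (g' : Matrix (Fin 2) (Fin 2) F) = (π : F) ^ a • (g : Matrix (Fin 2) (Fin 2) F) := by
    rw [Units.val_mul, coe_scaledGL]
    simp
  obtain ⟨κ, hκ⟩ := exists_integralGL_eq g' (fun i s => by
      rw [← hc, hg', Matrix.smul_apply, smul_eq_mul, norm_mul]
      exact mul_le_mul_of_nonneg_left (norm_le_entryNorm _ i s) (norm_nonneg _)) (by
      rw [hg', Matrix.det_smul, norm_mul, ← hsq, Fintype.card_fin, norm_pow, ← mul_pow, hc,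
        one_pow])
  refine ⟨(κ, 1) * (1, Multiplicative.ofAdd a)⁻¹, ?_⟩
  rw [map_mul, scaledGL_one, ← hκ, map_inv]
  exact (mul_inv_cancel_right _ _).symm

theorem exists_treeDist_lt {π : Fˣ} (hπ : (π : F) = p) (g : GL (Fin 2) F)
    (h : treeDist p g ≠ 0) : ∃ κ, treeDist p (g * scaledGL π κ * atkinLehner π) < treeDist p g := by
  have hp1 : (1 : ℝ) < p := by exact_mod_cast hp.out.one_lt
  suffices hs : ∃ κ : GL (Fin 2) (unitBall F),
      colNorm ((g * integralGL F κ : GL (Fin 2) F) : Matrix (Fin 2) (Fin 2) F) 0 <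
      colNorm ((g * integralGL F κ : GL (Fin 2) F) : Matrix (Fin 2) (Fin 2) F) 1 by
    obtain ⟨κ, hκ⟩ := hs
    refine ⟨(κ, 1), ?_⟩
    have := (hF.treeDist_mul_atkinLehner_lt_iff hπ _).mpr hκ
    rwa [← scaledGL_one π, hF.treeDist_mul_scaledGL] at this
  have hpos := entryNorm_pos g
  by_cases h1 : colNorm (g : Matrix (Fin 2) (Fin 2) F) 1 = entryNorm (g : Matrix (Fin 2) (Fin 2) F)
  · obtain ⟨i, hi⟩ := exists_norm_eq_colNorm (g : Matrix (Fin 2) (Fin 2) F) 1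
    rw [h1] at hi
    have hi0 : (g : Matrix (Fin 2) (Fin 2) F) i 1 ≠ 0 := norm_pos_iff.mp (hi ▸ hpos)
    let x : unitBall F := ⟨-((g : Matrix (Fin 2) (Fin 2) F) i 0 / (g : Matrix (Fin 2) (Fin 2) F) i 1),
      by
        rw [mem_unitBall, norm_neg, norm_div, hi]
        exact div_le_one_of_le₀ (norm_le_entryNorm _ _ _) hpos.le⟩
    refine ⟨lowerGL x, ?_⟩
    have hcoe : (integralGL F (lowerGL x) : Matrix (Fin 2) (Fin 2) F) = !![1, 0; (x : F), 1] := by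
      ext i s
      rw [coe_integralGL_apply, coe_lowerGL]
      fin_cases i <;> fin_cases s <;> rfl
    have hc1 : colNorm ((g * integralGL F (lowerGL x) : GL (Fin 2) F) :
        Matrix (Fin 2) (Fin 2) F) 1 = entryNorm (g : Matrix (Fin 2) (Fin 2) F) := by
      rw [← h1, Units.val_mul, hcoe]
      simp [colNorm, Matrix.mul_apply]
    rw [hc1]
    have hdet : ‖(g : Matrix (Fin 2) (Fin 2) F).det‖ < entryNorm (g : Matrix (Fin 2) (Fin 2) F) ^ 2 := by
      rw [hF.entryNorm_sq]
      exact lt_mul_of_one_lt_left (norm_det_pos g) (one_lt_pow₀ hp1 h)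
    have hent (t : Fin 2) : ‖((g : Matrix (Fin 2) (Fin 2) F) *
        (integralGL F (lowerGL x) : Matrix (Fin 2) (Fin 2) F)) t 0‖ *
          entryNorm (g : Matrix (Fin 2) (Fin 2) F) < entryNorm (g : Matrix (Fin 2) (Fin 2) F) ^ 2 := by
      refine lt_of_le_of_lt ?_ hdet
      rw [← hi, ← norm_mul, hcoe, Matrix.mul_apply, Fin.sum_univ_two, Matrix.det_fin_two]
      have hx : (x : F) * (g : Matrix (Fin 2) (Fin 2) F) i 1 =
          - (g : Matrix (Fin 2) (Fin 2) F) i 0 := by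
        simp only [x]
        field_simp
      have hx' : ((g : Matrix (Fin 2) (Fin 2) F) t 0 * !![1, 0; (x : F), 1] 0 0 +
          (g : Matrix (Fin 2) (Fin 2) F) t 1 * !![1, 0; (x : F), 1] 1 0) *
          (g : Matrix (Fin 2) (Fin 2) F) i 1 =
          (g : Matrix (Fin 2) (Fin 2) F) t 0 * (g : Matrix (Fin 2) (Fin 2) F) i 1 -
          (g : Matrix (Fin 2) (Fin 2) F) t 1 * (g : Matrix (Fin 2) (Fin 2) F) i 0 := by
        simp only [Matrix.of_apply, Matrix.cons_val', Matrix.cons_val_zero, Matrix.cons_val_one,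
          Matrix.cons_val_fin_one]
        linear_combination (g : Matrix (Fin 2) (Fin 2) F) t 1 * hx
      rw [hx']
      fin_cases i <;> fin_cases t
      · simp [mul_comm]
      · simp only [Fin.mk_one, Fin.zero_eta]
        rw [← norm_neg]
        exact le_of_eq (congrArg _ (by ring))
      · exact le_of_eq (congrArg _ (by simp))
      · simp [mul_comm]
    rw [Units.val_mul, colNorm, max_lt_iff]
    rw [sq] at hent
    exact ⟨lt_of_mul_lt_mul_right (hent 0) hpos.le, lt_of_mul_lt_mul_right (hent 1) hpos.le⟩
  · have hlt := lt_of_le_of_ne (colNorm_le_entryNorm (g : Matrix (Fin 2) (Fin 2) F) 1) h1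
    have h0 : colNorm (g : Matrix (Fin 2) (Fin 2) F) 0 = entryNorm (g : Matrix (Fin 2) (Fin 2) F) := by
      obtain ⟨s, hs⟩ := exists_colNorm_eq_entryNorm (g : Matrix (Fin 2) (Fin 2) F)
      fin_cases s
      · exact hs
      · exact absurd hs h1
    rw [← h0] at hlt
    refine ⟨upperWeylGL 0, ?_⟩
    have hcoe : (integralGL F (upperWeylGL 0) : Matrix (Fin 2) (Fin 2) F) = !![0, -1; 1, 0] := by
      ext i s
      rw [coe_integralGL_apply, coe_upperWeylGL]
      fin_cases i <;> fin_cases s <;> simp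
    rw [Units.val_mul, hcoe]
    simpa [colNorm, Matrix.mul_apply] using hlt

theorem exists_eq_p_mul {x : unitBall F} (hx : ‖(x : F)‖ < 1) : ∃ y : unitBall F, x = p * y := by
  have hp1 : (1 : ℝ) < p := by exact_mod_cast hp.out.one_lt
  have hp0 : (p : F) ≠ 0 := by
    rw [← norm_pos_iff, hF.norm_p]
    exact inv_pos.mpr (zero_lt_one.trans hp1)
  have h := hF.le_inv_mul_of_lt (x := (x : F)) (y := 1) (by rwa [norm_one])
  refine ⟨⟨(p : F)⁻¹ * x, ?_⟩, Subtype.ext ?_⟩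
  · rw [norm_one, mul_one] at h
    rw [mem_unitBall, norm_mul, norm_inv, hF.norm_p, inv_inv]
    calc (p : ℝ) * ‖(x : F)‖ ≤ p * (p : ℝ)⁻¹ := by gcongr
      _ = 1 := mul_inv_cancel₀ (zero_lt_one.trans hp1).ne'
  · push_cast
    rw [mul_inv_cancel_left₀ hp0]

theorem exists_conj_of_lt {π : Fˣ} (hπ : (π : F) = p) (g : GL (Fin 2) F)
    (κ κ' : GL (Fin 2) (unitBall F) × Multiplicative ℤ)
    (h : treeDist p (g * scaledGL π κ * atkinLehner π) < treeDist p g)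
    (h' : treeDist p (g * scaledGL π κ' * atkinLehner π) < treeDist p g) :
    ∃ κ'', scaledGL π κ'' * atkinLehner π = atkinLehner π * scaledGL π (κ⁻¹ * κ') := by
  rw [← hF.treeDist_mul_scaledGL π g κ, hF.treeDist_mul_atkinLehner_lt_iff hπ] at h
  rw [← hF.treeDist_mul_scaledGL π g κ', hF.treeDist_mul_atkinLehner_lt_iff hπ] at h'
  obtain ⟨⟨η, n⟩, hη⟩ : ∃ η, η = κ⁻¹ * κ' := ⟨_, rfl⟩
  rw [← hη]
  have hκ' : κ' = κ * (η, n) := by rw [hη, mul_inv_cancel_left]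
  rw [hκ', map_mul, ← mul_assoc] at h'
  generalize g * scaledGL π κ = g' at h h'
  obtain ⟨γ, hγ⟩ : ∃ γ, (η : Matrix (Fin 2) (Fin 2) (unitBall F)) 1 0 = p * γ := by
    apply hF.exists_eq_p_mul
    by_contra! hcon
    have h1 : ‖((η : Matrix (Fin 2) (Fin 2) (unitBall F)) 1 0 : F)‖ = 1 :=
      le_antisymm (unitBall_norm_le _) hcon
    rw [Units.val_mul, coe_scaledGL, Matrix.mul_smul, colNorm_smul, colNorm_smul] at h'
    have h2 := lt_of_mul_lt_mul_left h' (norm_nonneg _)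
    have h3 : colNorm ((g' : Matrix (Fin 2) (Fin 2) F) * (integralGL F η :
        Matrix (Fin 2) (Fin 2) F)) 1 ≤ colNorm (g' : Matrix (Fin 2) (Fin 2) F) 1 := by
      refine (colNorm_le_entryNorm _ 1).trans ?_
      rw [entryNorm_mul_integralGL, entryNorm, max_eq_right h.le]
    refine absurd (h2.trans_le h3) (not_lt.mpr ?_)
    obtain ⟨i, hi⟩ := exists_norm_eq_colNorm (g' : Matrix (Fin 2) (Fin 2) F) 1
    refine le_trans ?_ (norm_le_colNorm _ i 0)
    rw [Matrix.mul_apply, Fin.sum_univ_two]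
    have h4 : ‖(g' : Matrix (Fin 2) (Fin 2) F) i 1 *
        (integralGL F η : Matrix (Fin 2) (Fin 2) F) 1 0‖ =
        colNorm (g' : Matrix (Fin 2) (Fin 2) F) 1 := by
      rw [norm_mul, coe_integralGL_apply, h1, mul_one, hi]
    have h5 : ‖(g' : Matrix (Fin 2) (Fin 2) F) i 0 *
        (integralGL F η : Matrix (Fin 2) (Fin 2) F) 0 0‖ <
        colNorm (g' : Matrix (Fin 2) (Fin 2) F) 1 := by
      rw [norm_mul, coe_integralGL_apply]
      exact ((mul_le_of_le_one_right (norm_nonneg _) (unitBall_norm_le _)).trans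
        (norm_le_colNorm _ i 0)).trans_lt h
    rw [IsUltrametricDist.norm_add_eq_max_of_norm_ne_norm (by rw [h4]; exact h5.ne), h4,
      max_eq_right h5.le]
  have hdet := (Matrix.isUnit_iff_isUnit_det _).mp η.isUnit
  rw [Matrix.det_fin_two, hγ] at hdet
  refine ⟨(Matrix.GeneralLinearGroup.mk'' !![(η : Matrix (Fin 2) (Fin 2) (unitBall F)) 1 1, γ;
    p * (η : Matrix (Fin 2) (Fin 2) (unitBall F)) 0 1,
    (η : Matrix (Fin 2) (Fin 2) (unitBall F)) 0 0] ?_, n), ?_⟩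
  · rw [Matrix.det_fin_two_of]
    convert hdet using 1
    ring
  · refine Units.ext ?_
    have hγ' := congrArg (Subtype.val) hγ
    rw [Units.val_mul, Units.val_mul, coe_scaledGL, coe_scaledGL, Matrix.mul_smul,
      Matrix.smul_mul]
    congr 1
    ext i s
    rw [Matrix.mul_apply, Matrix.mul_apply, Fin.sum_univ_two, Fin.sum_univ_two,
      coe_atkinLehner]
    simp only [coe_integralGL_apply]
    fin_cases i <;> fin_cases s <;> simp [hπ, hγ', mul_comm]

theorem exists_coe_eq_of_conj {π : Fˣ} (hπ : (π : F) = p)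
    (κ κ' : GL (Fin 2) (unitBall F) × Multiplicative ℤ)
    (h : scaledGL π κ * atkinLehner π = atkinLehner π * scaledGL π κ') :
    ∃ α β γ δ : unitBall F,
      (κ.1 : Matrix (Fin 2) (Fin 2) (unitBall F)) = !![δ, γ; p * β, α] ∧
      (κ'.1 : Matrix (Fin 2) (Fin 2) (unitBall F)) = !![α, β; p * γ, δ] := by
  have hn : Multiplicative.toAdd κ.2 = Multiplicative.toAdd κ'.2 := by
    apply hF.zpow_eq_of_norm_eq hπ
    rw [← norm_det_scaledGL, ← norm_det_scaledGL]
    have h1 := congrArg (fun g : GL (Fin 2) F => ‖(g : Matrix (Fin 2) (Fin 2) F).det‖) h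
    simp only [Units.val_mul, Matrix.det_mul, norm_mul] at h1
    rw [mul_comm] at h1
    exact mul_left_cancel₀ (norm_det_pos (atkinLehner π)).ne' h1
  have h1 := congrArg (fun g : GL (Fin 2) F => (g : Matrix (Fin 2) (Fin 2) F)) h
  simp only [Units.val_mul, coe_scaledGL, Matrix.mul_smul, Matrix.smul_mul, hn] at h1
  have h2 := smul_right_injective _ (zpow_ne_zero (Multiplicative.toAdd κ'.2) π.ne_zero) h1
  have h3 (i s : Fin 2) := congrFun (congrFun h2 i) s
  simp only [Matrix.mul_apply, Fin.sum_univ_two, coe_atkinLehner, coe_integralGL_apply, hπ] at h3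
  have h00 := h3 0 0
  have h01 := h3 0 1
  have h10 := h3 1 0
  have h11 := h3 1 1
  simp at h00 h01 h10 h11
  refine ⟨(κ'.1 : Matrix (Fin 2) (Fin 2) (unitBall F)) 0 0,
    (κ'.1 : Matrix (Fin 2) (Fin 2) (unitBall F)) 0 1,
    (κ.1 : Matrix (Fin 2) (Fin 2) (unitBall F)) 0 1,
    (κ.1 : Matrix (Fin 2) (Fin 2) (unitBall F)) 0 0, ?_, ?_⟩
  · ext i s
    fin_cases i <;> fin_cases s
    · rfl
    · rfl
    · exact h11
    · exact mul_left_cancel₀ (hπ ▸ π.ne_zero : (p : F) ≠ 0) ((mul_comm _ _).trans h10)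
  · ext i s
    fin_cases i <;> fin_cases s
    · rfl
    · rfl
    · exact h00.symm.trans (mul_comm _ _)
    · exact congrArg Subtype.val h01.symm

end IsUnramifiedNorm

end Scaled

section Field

variable {p : ℕ} [hp : Fact p.Prime] {F : Type*} [NormedField F] [NormedAlgebra ℚ_[p] F]

theorem norm_algebra_natCast (n : ℕ) : ‖(n : F)‖ = ‖(n : ℚ_[p])‖ := by
  rw [← norm_algebraMap' F (n : ℚ_[p]), map_natCast]

theorem norm_algebra_intCast (n : ℤ) : ‖(n : F)‖ = ‖(n : ℚ_[p])‖ := by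
  rw [← norm_algebraMap' F (n : ℚ_[p]), map_intCast]

theorem isUltrametricDist_of_padic (p : ℕ) [Fact p.Prime] (F : Type*) [NormedField F]
    [NormedAlgebra ℚ_[p] F] : IsUltrametricDist F :=
  IsUltrametricDist.isUltrametricDist_of_forall_norm_natCast_le_one fun n => by
    rw [norm_algebra_natCast (p := p)]
    exact IsUltrametricDist.norm_natCast_le_one _ _

variable [IsUltrametricDist F]

theorem norm_add_lt_one {x y : F} (hx : ‖x‖ < 1) (hy : ‖y‖ < 1) : ‖x + y‖ < 1 :=
  (IsUltrametricDist.norm_add_le_max _ _).trans_lt (max_lt hx hy)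

theorem norm_sub_lt_one {x y : F} (hx : ‖x‖ < 1) (hy : ‖y‖ < 1) : ‖x - y‖ < 1 := by
  rw [sub_eq_add_neg]
  exact norm_add_lt_one hx (by rwa [norm_neg])

omit [IsUltrametricDist F] in
theorem norm_eq_one_of_isPrimitiveRoot {n : ℕ} (hn : n ≠ 0) {ζ : F} (hζ : IsPrimitiveRoot ζ n) :
    ‖ζ‖ = 1 := by
  have h := congrArg norm hζ.pow_eq_one
  rw [norm_pow, norm_one] at h
  exact (pow_eq_one_iff_of_nonneg (norm_nonneg _) hn).mp h

theorem norm_one_sub_pow_eq_one {n : ℕ} {ζ : F} (hζ : IsPrimitiveRoot ζ (n + 1))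
    (hn : p.Coprime (n + 1)) {i : ℕ} (hi : i < n) : ‖1 - ζ ^ (i + 1)‖ = 1 := by
  have h1 := norm_eq_one_of_isPrimitiveRoot n.succ_ne_zero hζ
  have hle (j : ℕ) : ‖1 - ζ ^ (j + 1)‖ ≤ 1 := by
    rw [sub_eq_add_neg]
    refine (IsUltrametricDist.norm_add_le_max _ _).trans ?_
    simp [h1]
  have h := congrArg norm hζ.prod_one_sub_pow_eq_order
  rw [norm_prod, ← Nat.cast_succ, norm_algebra_natCast (p := p),
    Padic.norm_natCast_eq_one_iff.mpr hn, ← Finset.mul_prod_erase _ _ (Finset.mem_range.mpr hi)] at h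
  have h2 : ∏ j ∈ (Finset.range n).erase i, ‖1 - ζ ^ (j + 1)‖ ≤ 1 :=
    Finset.prod_le_one (fun _ _ => norm_nonneg _) fun j _ => hle j
  have h3 : 0 ≤ ‖1 - ζ ^ (i + 1)‖ := norm_nonneg _
  nlinarith [hle i]

theorem norm_primitiveRoot_sub_natCast {ζ : F} (hζ : IsPrimitiveRoot ζ (p ^ 2 - 1)) (a : ℕ) :
    ‖ζ - a‖ = 1 := by
  have hp1 := hp.out.two_le
  have hn : p ^ 2 - 1 ≠ 0 := by
    have : 2 ^ 2 ≤ p ^ 2 := Nat.pow_le_pow_left hp1 2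
    omega
  have h1 := norm_eq_one_of_isPrimitiveRoot hn hζ
  have hle : ‖ζ - a‖ ≤ 1 := by
    rw [sub_eq_add_neg]
    refine (IsUltrametricDist.norm_add_le_max _ _).trans (max_le h1.le ?_)
    rw [norm_neg]
    exact IsUltrametricDist.norm_natCast_le_one _ _
  refine le_antisymm hle ?_
  by_contra! hcon
  have ha : ‖(a : F)‖ ≤ 1 := IsUltrametricDist.norm_natCast_le_one _ _
  have h2 : ‖ζ ^ p - (a : F) ^ p‖ < 1 := by
    rw [← Commute.geom_sum₂_mul (Commute.all ζ (a : F)) p, norm_mul]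
    refine (mul_le_of_le_one_left (norm_nonneg _) ?_).trans_lt hcon
    refine IsUltrametricDist.norm_sum_le_of_forall_le_of_nonneg zero_le_one fun i _ => ?_
    rw [norm_mul, norm_pow, norm_pow, h1, one_pow, one_mul]
    exact pow_le_one₀ (norm_nonneg _) ha
  have h3 : ‖(a : F) ^ p - a‖ < 1 := by
    have : ((((a : ℤ) ^ p - a : ℤ)) : F) = (a : F) ^ p - a := by push_cast; rfl
    rw [← this, norm_algebra_intCast (p := p), Padic.norm_intCast_lt_one_iff,
      ← ZMod.intCast_zmod_eq_zero_iff_dvd]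
    push_cast
    rw [ZMod.pow_card, sub_self]
  have h4 : ‖ζ - ζ ^ p‖ < 1 := by
    have := norm_sub_lt_one (norm_sub_lt_one hcon h2) h3
    convert this using 2
    ring
  have h5 : ‖1 - ζ ^ (p - 2 + 1)‖ = 1 := by
    have hle2 : p * 2 ≤ p * p := Nat.mul_le_mul_left _ hp1
    have h6 : p ^ 2 - 1 = (p ^ 2 - 2) + 1 := by rw [sq]; omega
    rw [h6] at hζ
    refine norm_one_sub_pow_eq_one (p := p) hζ ?_ (by rw [sq]; omega)
    rw [← h6]
    have h7 : (p ^ 2 - 1) + 1 = p * p := by rw [sq]; omega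
    have h8 : Nat.Coprime (p * p) (p ^ 2 - 1) := by
      rw [← h7]
      rw [Nat.coprime_self_add_left]
      exact Nat.coprime_one_left _
    exact h8.coprime_mul_right
  have h9 : ζ - ζ ^ p = ζ * (1 - ζ ^ (p - 2 + 1)) := by
    rw [mul_sub, mul_one, ← pow_succ', show p - 2 + 1 + 1 = p by omega]
  rw [h9, norm_mul, h1, h5, one_mul] at h4
  exact lt_irrefl _ h4

theorem norm_primitiveRoot_add_algebraMap {ζ : F} (hζ : IsPrimitiveRoot ζ (p ^ 2 - 1)) (x : ℚ_[p])
    (hx : ‖x‖ ≤ 1) : ‖algebraMap ℚ_[p] F x + ζ‖ = 1 := by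
  obtain ⟨n, -, hn⟩ := PadicInt.exists_mem_range (p := p) ⟨-x, by rwa [norm_neg]⟩
  rw [IsLocalRing.mem_maximalIdeal, PadicInt.mem_nonunits] at hn
  have h1 : ‖algebraMap ℚ_[p] F (-x - n)‖ < 1 := by
    rw [norm_algebraMap']
    exact hn
  have h2 := norm_primitiveRoot_sub_natCast hζ n
  have h3 : algebraMap ℚ_[p] F x + ζ = (ζ - n) + - algebraMap ℚ_[p] F (-x - n) := by
    rw [map_sub, map_neg, map_natCast]
    ring
  rw [h3, IsUltrametricDist.norm_add_eq_max_of_norm_ne_norm, norm_neg, h2, max_eq_left h1.le]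
  rw [norm_neg, h2]
  exact h1.ne'

theorem norm_algebraMap_add_mul {ζ : F} (hζ : IsPrimitiveRoot ζ (p ^ 2 - 1)) (x y : ℚ_[p]) :
    ‖algebraMap ℚ_[p] F x + algebraMap ℚ_[p] F y * ζ‖ = max ‖x‖ ‖y‖ := by
  have hζ1 : ‖ζ‖ = 1 := by
    have := norm_primitiveRoot_sub_natCast hζ 0
    rwa [Nat.cast_zero, sub_zero] at this
  by_cases h : ‖x‖ = ‖y‖
  · by_cases hy : y = 0
    · rw [hy, norm_zero, norm_eq_zero] at h
      simp [h, hy]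
    · have h1 : algebraMap ℚ_[p] F x + algebraMap ℚ_[p] F y * ζ =
          algebraMap ℚ_[p] F y * (algebraMap ℚ_[p] F (x / y) + ζ) := by
        rw [mul_add, ← map_mul, mul_div_cancel₀ _ hy]
      rw [h1, norm_mul, norm_primitiveRoot_add_algebraMap hζ, norm_algebraMap', h, max_self,
        mul_one]
      rw [norm_div, h]
      exact div_self_le_one _
  · have h1 : ‖algebraMap ℚ_[p] F y * ζ‖ = ‖y‖ := by
      rw [norm_mul, norm_algebraMap', hζ1, mul_one]
    rw [IsUltrametricDist.norm_add_eq_max_of_norm_ne_norm, norm_algebraMap', h1]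
    rwa [norm_algebraMap', h1]

theorem exists_eq_algebraMap_add_mul [FiniteDimensional ℚ_[p] F]
    (hdeg : Module.finrank ℚ_[p] F = 2) {ζ : F} (hζ : IsPrimitiveRoot ζ (p ^ 2 - 1)) (z : F) :
    ∃ x y : ℚ_[p], z = algebraMap ℚ_[p] F x + algebraMap ℚ_[p] F y * ζ := by
  have hli : LinearIndependent ℚ_[p] ![(1 : F), ζ] := by
    rw [LinearIndependent.pair_iff]
    intro s t h
    have h1 := norm_algebraMap_add_mul hζ s t
    rw [← mul_one (algebraMap ℚ_[p] F s), ← Algebra.smul_def, ← Algebra.smul_def, h,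
      norm_zero] at h1
    exact ⟨norm_le_zero_iff.mp (h1 ▸ le_max_left _ _), norm_le_zero_iff.mp (h1 ▸ le_max_right _ _)⟩
  have hspan := hli.span_eq_top_of_card_eq_finrank (by simp [hdeg])
  have hz : z ∈ Submodule.span ℚ_[p] (Set.range ![(1 : F), ζ]) := hspan ▸ Submodule.mem_top
  rw [Matrix.range_cons, Matrix.range_cons, Matrix.range_empty, Set.union_empty,
    Set.singleton_union, Submodule.mem_span_pair] at hz
  obtain ⟨x, y, h⟩ := hz
  exact ⟨x, y, by rw [← h, Algebra.smul_def, Algebra.smul_def, mul_one]⟩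

theorem isUnramifiedNorm_of_isPrimitiveRoot [FiniteDimensional ℚ_[p] F]
    (hdeg : Module.finrank ℚ_[p] F = 2) {ζ : F} (hζ : IsPrimitiveRoot ζ (p ^ 2 - 1)) :
    IsUnramifiedNorm p F where
  norm_p := by rw [norm_algebra_natCast (p := p), Padic.norm_p]
  exists_zpow z hz := by
    obtain ⟨x, y, rfl⟩ := exists_eq_algebraMap_add_mul hdeg hζ z
    rw [← norm_pos_iff] at hz
    rw [norm_algebraMap_add_mul hζ] at hz ⊢
    have key (x : ℚ_[p]) (hx : 0 < ‖x‖) : ∃ n : ℤ, ‖x‖ = (p : ℝ) ^ n :=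
      ⟨_, Padic.norm_eq_zpow_neg_valuation (norm_pos_iff.mp hx)⟩
    rcases max_choice ‖x‖ ‖y‖ with h | h <;> rw [h] at hz ⊢ <;> exact key _ hz

omit [NormedAlgebra ℚ_[p] F] in
theorem IsUnramifiedNorm.norm_lt_one_iff (hF : IsUnramifiedNorm p F) (x : unitBall F) :
    ‖(x : F)‖ < 1 ↔ x ∈ Ideal.span {(p : unitBall F)} := by
  have hp1 : (1 : ℝ) < p := by exact_mod_cast hp.out.one_lt
  rw [Ideal.mem_span_singleton]
  refine ⟨fun h => hF.exists_eq_p_mul h, ?_⟩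
  rintro ⟨y, rfl⟩
  push_cast
  rw [norm_mul, hF.norm_p]
  exact (mul_le_of_le_one_right (by positivity) (unitBall_norm_le y)).trans_lt
    (inv_lt_one_of_one_lt₀ hp1)

omit [NormedAlgebra ℚ_[p] F] in
theorem IsUnramifiedNorm.isMaximal_span (hF : IsUnramifiedNorm p F) :
    (Ideal.span {(p : unitBall F)}).IsMaximal := by
  rw [Ideal.isMaximal_iff]
  refine ⟨fun h => ?_, fun J x _ hx hxJ => ?_⟩
  · rw [← hF.norm_lt_one_iff] at h
    simp at h
  · rw [← hF.norm_lt_one_iff, not_lt] at hx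
    have := isUnit_of_norm_coe_eq_one (le_antisymm (unitBall_norm_le x) hx)
    rw [Ideal.eq_top_of_isUnit_mem J hxJ this]
    trivial

/-- Every integral element is congruent to a combination of `1` and `ζ` with digits as
coefficients. -/
theorem card_quotient_span [FiniteDimensional ℚ_[p] F]
    (hdeg : Module.finrank ℚ_[p] F = 2) {ζ : F} (hζ : IsPrimitiveRoot ζ (p ^ 2 - 1)) :
    Nat.card (unitBall F ⧸ Ideal.span {(p : unitBall F)}) = p ^ 2 := by
  have hF := isUnramifiedNorm_of_isPrimitiveRoot hdeg hζ
  have hζ1 : ‖ζ‖ = 1 := by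
    have := norm_primitiveRoot_sub_natCast hζ 0
    rwa [Nat.cast_zero, sub_zero] at this
  let ζ' : unitBall F := ⟨ζ, hζ1.le⟩
  let f : Fin p × Fin p → unitBall F ⧸ Ideal.span {(p : unitBall F)} := fun a =>
    Ideal.Quotient.mk _ (((a.1 : ℕ) : unitBall F) + ((a.2 : ℕ) : unitBall F) * ζ')
  have hf : Function.Bijective f := by
    constructor
    · intro a b hab
      have h := Ideal.Quotient.eq.mp hab
      rw [← hF.norm_lt_one_iff] at h
      have h1 := norm_algebraMap_add_mul hζ (((a.1 : ℕ) - (b.1 : ℕ) : ℤ) : ℚ_[p])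
        (((a.2 : ℕ) - (b.2 : ℕ) : ℤ) : ℚ_[p])
      have h2 : ‖algebraMap ℚ_[p] F (((a.1 : ℕ) - (b.1 : ℕ) : ℤ) : ℚ_[p]) +
          algebraMap ℚ_[p] F (((a.2 : ℕ) - (b.2 : ℕ) : ℤ) : ℚ_[p]) * ζ‖ < 1 := by
        convert h using 2
        simp only [ζ', map_intCast]
        push_cast
        ring
      rw [h1, max_lt_iff, Padic.norm_intCast_lt_one_iff, Padic.norm_intCast_lt_one_iff] at h2
      have key (s t : Fin p) (h : (p : ℤ) ∣ (s : ℕ) - (t : ℕ)) : s = t := by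
        have h3 := (Int.natCast_modEq_iff.mp ((Int.modEq_iff_dvd).mpr h)).symm
        exact Fin.ext (Nat.ModEq.eq_of_lt_of_lt h3 s.2 t.2)
      exact Prod.ext (key _ _ h2.1) (key _ _ h2.2)
    · intro z
      obtain ⟨z, rfl⟩ := Ideal.Quotient.mk_surjective z
      obtain ⟨x, y, h⟩ := exists_eq_algebraMap_add_mul hdeg hζ (z : F)
      have hz := unitBall_norm_le z
      rw [h, norm_algebraMap_add_mul hζ, max_le_iff] at hz
      obtain ⟨a, ha, ha'⟩ := PadicInt.exists_mem_range (p := p) ⟨x, hz.1⟩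
      obtain ⟨b, hb, hb'⟩ := PadicInt.exists_mem_range (p := p) ⟨y, hz.2⟩
      rw [IsLocalRing.mem_maximalIdeal, PadicInt.mem_nonunits] at ha' hb'
      refine ⟨(⟨a, ha⟩, ⟨b, hb⟩), (Ideal.Quotient.eq.mpr ?_).symm⟩
      rw [← hF.norm_lt_one_iff]
      have h1 := norm_algebraMap_add_mul hζ (x - a) (y - b)
      have h2 : max ‖x - a‖ ‖y - b‖ < 1 := max_lt ha' hb'
      rw [← h1] at h2
      convert h2 using 2
      simp only [ζ', map_sub, map_natCast]
      push_cast
      rw [h]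
      ring
  rw [← Nat.card_congr (Equiv.ofBijective f hf), Nat.card_prod, Nat.card_fin, sq]

theorem exists_isQuadraticReduction {F : Type} [NormedField F] [NormedAlgebra ℚ_[p] F]
    [IsUltrametricDist F] [FiniteDimensional ℚ_[p] F]
    (hdeg : Module.finrank ℚ_[p] F = 2) {ζ : F} (hζ : IsPrimitiveRoot ζ (p ^ 2 - 1)) :
    ∃ (𝔽 : Type) (_ : Field 𝔽) (_ : Fintype 𝔽) (r : unitBall F →+* 𝔽),
      IsQuadraticReduction p r := by
  have hF := isUnramifiedNorm_of_isPrimitiveRoot hdeg hζ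
  have hmax := hF.isMaximal_span
  have hcard := card_quotient_span hdeg hζ
  have hfin : Finite (unitBall F ⧸ Ideal.span {(p : unitBall F)}) :=
    Nat.finite_of_card_ne_zero (by rw [hcard]; exact pow_ne_zero _ hp.out.ne_zero)
  have hfintype := Fintype.ofFinite (unitBall F ⧸ Ideal.span {(p : unitBall F)})
  refine ⟨unitBall F ⧸ Ideal.span {(p : unitBall F)}, Ideal.Quotient.field _, hfintype,
    Ideal.Quotient.mk _, ?_⟩
  have hmem (x : unitBall F) : Ideal.Quotient.mk (Ideal.span {(p : unitBall F)}) x = 0 ↔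
      ‖(x : F)‖ < 1 := by
    rw [Ideal.Quotient.eq_zero_iff_mem, hF.norm_lt_one_iff]
  have hp0 : (p : F) ≠ 0 := by
    rw [← norm_ne_zero_iff, hF.norm_p]
    exact inv_ne_zero (Nat.cast_ne_zero.mpr hp.out.ne_zero)
  refine @IsQuadraticReduction.mk p _ _ _ (Ideal.Quotient.field _) hfintype _ ?_ ?_ ?_ ?_ ?_ ?_
  · rw [← hcard, Nat.card_eq_fintype_card]
  · exact Ideal.Quotient.mk_surjective
  · exact Ideal.Quotient.eq_zero_iff_mem.mpr (Ideal.mem_span_singleton_self _)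
  · intro x hx
    exact Ideal.mem_span_singleton.mp (Ideal.Quotient.eq_zero_iff_mem.mp hx)
  · intro x hx
    have h := congrArg Subtype.val hx
    push_cast at h
    exact Subtype.ext ((mul_eq_zero.mp h).resolve_left hp0)
  · intro x hx
    rw [Ne, hmem, not_lt] at hx
    exact isUnit_of_norm_coe_eq_one (le_antisymm (unitBall_norm_le x) hx)

theorem IsQuadraticReduction.nonempty_ringHom {O 𝔽 : Type*} [CommRing O] [Field 𝔽] [Fintype 𝔽]
    {r : O →+* 𝔽} (hr : IsQuadraticReduction p r) :
    Nonempty (𝔽 →+* AlgebraicClosure (ZMod p)) := by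
  have := hr.charP
  let _ := ZMod.algebra 𝔽 p
  exact ⟨(IsAlgClosed.lift : 𝔽 →ₐ[ZMod p] AlgebraicClosure (ZMod p)).toRingHom⟩

end Field

section Congruence

variable {F : Type*} [NormedField F] [IsUltrametricDist F]

theorem norm_sub_one_mul_lt {g h : Matrix (Fin 2) (Fin 2) F}
    (hg : ∀ i s, ‖(g - 1) i s‖ < 1) (hh : ∀ i s, ‖(h - 1) i s‖ < 1) (i s : Fin 2) :
    ‖(g * h - 1) i s‖ < 1 := by
  have h1 : g * h - 1 = (g - 1) * (h - 1) + ((g - 1) + (h - 1)) := by noncomm_ring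
  rw [h1, Matrix.add_apply, Matrix.add_apply, Matrix.mul_apply, Fin.sum_univ_two]
  have key (l : Fin 2) : ‖(g - 1) i l * (h - 1) l s‖ < 1 := by
    rw [norm_mul]
    exact mul_lt_one_of_nonneg_of_lt_one_left (norm_nonneg _) (hg i l) (hh l s).le
  exact norm_add_lt_one (norm_add_lt_one (key 0) (key 1)) (norm_add_lt_one (hg i s) (hh i s))

theorem norm_le_one_of_norm_sub_one_lt {g : Matrix (Fin 2) (Fin 2) F}
    (hg : ∀ i s, ‖(g - 1) i s‖ < 1) (i s : Fin 2) : ‖g i s‖ ≤ 1 := by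
  have h1 : g i s = (g - 1) i s + (1 : Matrix (Fin 2) (Fin 2) F) i s := by simp
  rw [h1]
  refine (IsUltrametricDist.norm_add_le_max _ _).trans (max_le (hg i s).le ?_)
  rw [Matrix.one_apply]
  split <;> simp

theorem norm_det_sub_one_lt {g : Matrix (Fin 2) (Fin 2) F}
    (hg : ∀ i s, ‖(g - 1) i s‖ < 1) : ‖g.det - 1‖ < 1 := by
  have h1 : g.det - 1 = (g - 1) 0 0 * g 1 1 + (g - 1) 1 1 - (g - 1) 0 1 * (g - 1) 1 0 := by
    rw [Matrix.det_fin_two]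
    simp
    ring
  have hle := norm_le_one_of_norm_sub_one_lt hg
  rw [h1]
  refine norm_sub_lt_one (norm_add_lt_one ?_ (hg 1 1)) ?_ <;> rw [norm_mul]
  · exact mul_lt_one_of_nonneg_of_lt_one_left (norm_nonneg _) (hg 0 0) (hle 1 1)
  · exact mul_lt_one_of_nonneg_of_lt_one_left (norm_nonneg _) (hg 0 1) (hg 1 0).le

theorem norm_eq_one_of_norm_sub_one_lt {x : F} (hx : ‖x - 1‖ < 1) : ‖x‖ = 1 := by
  have h1 : x = (x - 1) + 1 := by ring
  rw [h1, IsUltrametricDist.norm_add_eq_max_of_norm_ne_norm, norm_one, max_eq_right hx.le]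
  rw [norm_one]
  exact hx.ne

theorem norm_inv_sub_one_lt (g : GL (Fin 2) F)
    (hg : ∀ i s, ‖((g : Matrix (Fin 2) (Fin 2) F) - 1) i s‖ < 1) (i s : Fin 2) :
    ‖(((g⁻¹ : GL (Fin 2) F) : Matrix (Fin 2) (Fin 2) F) - 1) i s‖ < 1 := by
  obtain ⟨κ, hκ⟩ := exists_integralGL_eq g (norm_le_one_of_norm_sub_one_lt hg)
    (norm_eq_one_of_norm_sub_one_lt (norm_det_sub_one_lt hg))
  have h1 : ((g⁻¹ : GL (Fin 2) F) : Matrix (Fin 2) (Fin 2) F) - 1 =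
      - (((g⁻¹ : GL (Fin 2) F) : Matrix (Fin 2) (Fin 2) F) *
        ((g : Matrix (Fin 2) (Fin 2) F) - 1)) := by
    rw [mul_sub, mul_one, Units.inv_mul, neg_sub]
  have hle (i s : Fin 2) : ‖((g⁻¹ : GL (Fin 2) F) : Matrix (Fin 2) (Fin 2) F) i s‖ ≤ 1 := by
    rw [hκ, ← map_inv, coe_integralGL_apply]
    exact unitBall_norm_le _
  rw [h1, Matrix.neg_apply, norm_neg, Matrix.mul_apply, Fin.sum_univ_two]
  have key (l : Fin 2) : ‖((g⁻¹ : GL (Fin 2) F) : Matrix (Fin 2) (Fin 2) F) i l *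
      ((g : Matrix (Fin 2) (Fin 2) F) - 1) l s‖ < 1 := by
    rw [norm_mul]
    exact mul_lt_one_of_nonneg_of_lt_one_right (hle i l) (norm_nonneg _) (hg l s)
  exact norm_add_lt_one (key 0) (key 1)

variable (F) in
/-- The first congruence subgroup of `GL₂`. -/
def congruenceSubgroup : Subgroup (GL (Fin 2) F) where
  carrier := {g | ∀ i s, ‖((g : Matrix (Fin 2) (Fin 2) F) - 1) i s‖ < 1}
  mul_mem' {g h} hg hh i s := norm_sub_one_mul_lt hg hh i s
  one_mem' i s := by simp
  inv_mem' {g} hg i s := norm_inv_sub_one_lt g hg i s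

theorem mem_congruenceSubgroup {g : GL (Fin 2) F} : g ∈ congruenceSubgroup F ↔
    ∀ i s, ‖((g : Matrix (Fin 2) (Fin 2) F) - 1) i s‖ < 1 := Iff.rfl

theorem isOpen_congruenceSubgroup : IsOpen (congruenceSubgroup F : Set (GL (Fin 2) F)) := by
  have h1 : (congruenceSubgroup F : Set (GL (Fin 2) F)) =
      ⋂ i, ⋂ s, {g : GL (Fin 2) F | ‖((g : Matrix (Fin 2) (Fin 2) F) - 1) i s‖ < 1} := by
    ext g
    simp [mem_congruenceSubgroup]
  rw [h1]
  refine isOpen_iInter_of_finite fun i => isOpen_iInter_of_finite fun s => ?_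
  refine isOpen_lt ?_ continuous_const
  exact (((Units.continuous_val.sub continuous_const).matrix_elem i s)).norm

theorem isCompact_congruenceSubgroup [ProperSpace F] :
    IsCompact (congruenceSubgroup F : Set (GL (Fin 2) F)) := by
  have hball : IsCompact ({x | ∀ i s, ‖x i s‖ ≤ 1} : Set (Matrix (Fin 2) (Fin 2) F)) := by
    have h1 : IsCompact (Set.univ.pi fun _ => Set.univ.pi fun _ => Metric.closedBall (0 : F) 1 :
        Set (Fin 2 → Fin 2 → F)) :=
      isCompact_univ_pi fun _ => isCompact_univ_pi fun _ => isCompact_closedBall 0 1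
    have h2 : ({x | ∀ i s, ‖x i s‖ ≤ 1} : Set (Fin 2 → Fin 2 → F)) =
        Set.univ.pi fun _ => Set.univ.pi fun _ => Metric.closedBall (0 : F) 1 := by
      ext x
      simp [Set.mem_pi]
    exact h2 ▸ h1
  have hcl : IsClosed (congruenceSubgroup F : Set (GL (Fin 2) F)) :=
    Subgroup.isClosed_of_isOpen _ isOpen_congruenceSubgroup
  have hemb : Topology.IsClosedEmbedding (Units.embedProduct (Matrix (Fin 2) (Fin 2) F)) :=
    Units.isClosedEmbedding_embedProduct
  refine (hemb.isCompact_preimage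
    (hball.prod (hball.image MulOpposite.continuous_op))).of_isClosed_subset hcl fun g hg => ?_
  have hg' := (congruenceSubgroup F).inv_mem hg
  exact ⟨norm_le_one_of_norm_sub_one_lt hg, _, norm_le_one_of_norm_sub_one_lt hg', rfl⟩

theorem IsUnramifiedNorm.exists_eq_of_mem_congruenceSubgroup {p : ℕ} [hp : Fact p.Prime]
    (hF : IsUnramifiedNorm p F) {𝔽 : Type*} [Field 𝔽] [Fintype 𝔽] {r : unitBall F →+* 𝔽}
    (hr : IsQuadraticReduction p r) {g : GL (Fin 2) F} (hg : g ∈ congruenceSubgroup F) :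
    ∃ (κ : GL (Fin 2) (unitBall F)) (α β γ δ : unitBall F), g = integralGL F κ ∧
      (κ : Matrix (Fin 2) (Fin 2) (unitBall F)) = !![α, β; p * γ, δ] ∧
      r α = 1 ∧ r β = 0 ∧ r δ = 1 := by
  rw [mem_congruenceSubgroup] at hg
  obtain ⟨κ, hκ⟩ := exists_integralGL_eq g (norm_le_one_of_norm_sub_one_lt hg)
    (norm_eq_one_of_norm_sub_one_lt (norm_det_sub_one_lt hg))
  have hκ' (i s) : ‖(((κ : Matrix (Fin 2) (Fin 2) (unitBall F)) - 1) i s : F)‖ < 1 := by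
    have h1 := hg i s
    rw [hκ, Matrix.sub_apply, coe_integralGL_apply] at h1
    convert h1 using 2
    rw [Matrix.sub_apply, Matrix.one_apply, Matrix.one_apply]
    split <;> simp
  have hr0 (x : unitBall F) (hx : ‖(x : F)‖ < 1) : r x = 0 := by
    obtain ⟨y, rfl⟩ := hF.exists_eq_p_mul hx
    rw [map_mul, hr.map_p, zero_mul]
  have h10 := hκ' 1 0
  rw [Matrix.sub_apply, Matrix.one_apply_ne (by decide), sub_zero] at h10
  obtain ⟨γ, hγ⟩ := hF.exists_eq_p_mul h10
  refine ⟨κ, κ.val 0 0, κ.val 0 1, γ, κ.val 1 1, hκ, ?_, ?_, ?_, ?_⟩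
  · rw [← hγ]
    exact Matrix.eta_fin_two _
  · have := hr0 _ (hκ' 0 0)
    rwa [Matrix.sub_apply, Matrix.one_apply_eq, map_sub, map_one, sub_eq_zero] at this
  · have := hr0 _ (hκ' 0 1)
    rwa [Matrix.sub_apply, Matrix.one_apply_ne (by decide), sub_zero] at this
  · have := hr0 _ (hκ' 1 1)
    rwa [Matrix.sub_apply, Matrix.one_apply_eq, map_sub, map_one, sub_eq_zero] at this

end Congruence

/-- For an odd prime `p`, with `F` the unramified quadratic extension of
`ℚ_p` (characterized as a normed `ℚ_p`-algebra field of degree 2 containing a primitive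
`(p^2-1)`-st root of unity) and `k` an algebraic closure of `𝔽_p`, there exists a smooth
irreducible non-admissible `k`-linear representation of `G = GL₂(F)`. -/
theorem exists_smooth_irreducible_nonadmissible
    (p : ℕ) [Fact p.Prime] (hp : Odd p)
    (F : Type) [NormedField F] [NormedAlgebra ℚ_[p] F] [FiniteDimensional ℚ_[p] F]
    (hdeg : Module.finrank ℚ_[p] F = 2)
    (hunram : ∃ ζ : F, IsPrimitiveRoot ζ (p ^ 2 - 1)) :
    ∃ (V : Type) (_ : AddCommGroup V) (_ : Module (AlgebraicClosure (ZMod p)) V)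
      (ρ : Representation (AlgebraicClosure (ZMod p)) (GL (Fin 2) F) V),
      -- smooth: every vector has open stabilizer
      (∀ v : V, IsOpen {g : GL (Fin 2) F | ρ g v = v}) ∧
      -- irreducible: nonzero, and the only G-stable subspaces are 0 and V
      Nontrivial V ∧
      (∀ W : Submodule (AlgebraicClosure (ZMod p)) V,
        (∀ (g : GL (Fin 2) F), ∀ v ∈ W, ρ g v ∈ W) → W = ⊥ ∨ W = ⊤) ∧
      -- non-admissible: not every compact open subgroup has finite-dimensional invariants
      ¬ (∀ H : Subgroup (GL (Fin 2) F), IsOpen (H : Set (GL (Fin 2) F)) →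
          IsCompact (H : Set (GL (Fin 2) F)) →
          FiniteDimensional (AlgebraicClosure (ZMod p))
             (Representation.invariants (ρ.comp H.subtype))) := by
  obtain ⟨ζ, hζ⟩ := hunram
  have := isUltrametricDist_of_padic p F
  have : ProperSpace F := FiniteDimensional.proper ℚ_[p] F
  have hF := isUnramifiedNorm_of_isPrimitiveRoot hdeg hζ
  obtain ⟨𝔽, _, _, r, hr⟩ := exists_isQuadraticReduction hdeg hζ
  obtain ⟨ι⟩ := hr.nonempty_ringHom
  have hp0 : (p : F) ≠ 0 := by
    rw [← norm_ne_zero_iff, hF.norm_p]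
    exact inv_ne_zero (Nat.cast_ne_zero.mpr (Fact.out : p.Prime).ne_zero)
  let π : Fˣ := Units.mk0 (p : F) hp0
  have hπ : (π : F) = p := rfl
  obtain ⟨V, i1, i2, ρ, hsmooth, hnt, hirr, hinf⟩ := hr.exists_irreducible hp ι (scaledGL π)
    (hF.scaledGL_injective hπ) (atkinLehner π) (Multiplicative.ofAdd 1) (atkinLehner_mul_self π)
    (hF.exists_coe_eq_of_conj hπ) (treeDist p)
    (IsUnramifiedNorm.treeDist_eq (by simp [entryNorm_one]))
    (hF.treeDist_mul_scaledGL π) (hF.exists_eq_scaledGL hπ) (hF.exists_treeDist_lt hπ)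
    (hF.exists_conj_of_lt hπ) (hF.treeDist_mul_atkinLehner_ne hπ)
    (congruenceSubgroup F) isOpen_congruenceSubgroup fun h hh => by
      obtain ⟨κ, α, β, γ, δ, h1, h2⟩ := hF.exists_eq_of_mem_congruenceSubgroup hr hh
      exact ⟨κ, α, β, γ, δ, by rw [scaledGL_one, h1], h2⟩
  exact ⟨V, i1, i2, ρ, hsmooth, hnt, hirr,
    fun h => hinf (h _ isOpen_congruenceSubgroup isCompact_congruenceSubgroup)⟩
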